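/- Let {s_n} ⊂ (0,1) be a sequence of rational numbers converging to an irrational s ∈ (0,1). Then for every periodic tile P of Δ_s there exist, for all sufficiently large n, periodic tiles P_n of Δ_{s_n} such that the sequence {P_n} converges to P in the Hausdorff metric on compact subsets of ℝ². -/

import Mathlib

noncomputable section

open Set Topology Filter

/-- The parallelogram `X_s = F₁(s)`, centered at the origin and spanned by the
vectors `(2,0)` and `(2s,2s)`. -/
def F1 (s : ℝ) : Set (ℝ × ℝ) :=
  {p | ∃ a b : ℝ, a ∈ Icc (-(1:ℝ)/2) (1/2) ∧ b ∈ Icc (-(1:ℝ)/2) (1/2) ∧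
    p = (2 * a + 2 * s * b, 2 * s * b)}

/-- Rotation by `π/2` about the origin. -/
def rotQ (p : ℝ × ℝ) : ℝ × ℝ := (-p.2, p.1)

/-- `F₂(s)`, the image of `F₁(s)` under rotation by `π/2` about the origin. -/
def F2 (s : ℝ) : Set (ℝ × ℝ) := rotQ '' F1 s

/-- The lattice `L₁` generated by `(0,2)` and `(2s,2s)`. -/
def L1 (s : ℝ) : Set (ℝ × ℝ) :=
  {v | ∃ m n : ℤ, v = (2 * s * n, 2 * m + 2 * s * n)}

/-- The lattice `L₂` generated by `(2,0)` and `(2s,−2s)`. -/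
def L2 (s : ℝ) : Set (ℝ × ℝ) :=
  {v | ∃ m n : ℤ, v = (2 * m + 2 * s * n, -(2 * s * n))}

/-- `F_j` indexed by `Fin 2` (index `0` is `F₁`, index `1` is `F₂`). -/
def FF (s : ℝ) : Fin 2 → Set (ℝ × ℝ) := fun j => if j = 0 then F1 s else F2 s

/-- `L_j` indexed by `Fin 2` (index `0` is `L₁`, index `1` is `L₂`). -/
def LL (s : ℝ) : Fin 2 → Set (ℝ × ℝ) := fun j => if j = 0 then L1 s else L2 s

/-- One application of the map `f′`, as a relation: `StepRel s p q` holds iff `p ∈ F_j`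
for some `j`, there is a unique `v ∈ L_{3−j}` with `p + v ∈ F_{3−j}`, and `q = p + v`
(i.e. `q − p ∈ L_{3−j}` and `q ∈ F_{3−j}`).  `f′` is undefined where the translation
is not unique. -/
def StepRel (s : ℝ) (p q : ℝ × ℝ) : Prop :=
  ∃ j : Fin 2, p ∈ FF s j ∧ (∃! v, v ∈ LL s (j + 1) ∧ p + v ∈ FF s (j + 1)) ∧
    q - p ∈ LL s (j + 1) ∧ q ∈ FF s (j + 1)

/-- The octagonal PET map `f_s = (f′)²`, as a relation. -/
def MapRel (s : ℝ) (p q : ℝ × ℝ) : Prop := ∃ r, StepRel s p r ∧ StepRel s r q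

/-- `n`-fold iteration of the (partially defined) map `f_s`, as a relation. -/
def IterRel (s : ℝ) : ℕ → ℝ × ℝ → ℝ × ℝ → Prop
  | 0, p, q => p = q
  | n + 1, p, q => ∃ r, IterRel s n p r ∧ MapRel s r q

/-- A convex polygon: the convex hull of a finite set of points, with nonempty interior. -/
def IsConvexPolygon (P : Set (ℝ × ℝ)) : Prop :=
  (∃ V : Finset (ℝ × ℝ), P = convexHull ℝ (V : Set (ℝ × ℝ))) ∧ (interior P).Nonempty

/-- A periodic tile of `(X_s, f_s)`: a maximal convex polygon in `X_s` on whose interior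
`f_s` and all its iterates are defined and periodic. -/
def IsPeriodicTile (s : ℝ) (P : Set (ℝ × ℝ)) : Prop :=
  IsConvexPolygon P ∧ P ⊆ F1 s ∧
    (∃ n, 0 < n ∧ ∀ p ∈ interior P, IterRel s n p p) ∧
    ∀ Q, IsConvexPolygon Q → Q ⊆ F1 s →
      (∃ n, 0 < n ∧ ∀ p ∈ interior Q, IterRel s n p p) → P ⊆ Q → P = Q

/-- The tiling `Δ_s`: the collection of all periodic tiles. -/
def tiles (s : ℝ) : Set (Set (ℝ × ℝ)) := {P | IsPeriodicTile s P}

/-- The limit set `Λ̂_s`: points of `X_s` every neighborhood of which meets infinitely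
many tiles of `Δ_s`. -/
def limitSet (s : ℝ) : Set (ℝ × ℝ) :=
  {p | p ∈ F1 s ∧ ∀ U ∈ 𝓝 p, {P ∈ tiles s | (U ∩ P).Nonempty}.Infinite}

/-- The renormalization map `R`. -/
def Rmap (x : ℝ) : ℝ :=
  if x < 1 / 2 then 1 / (2 * x) - (⌊1 / (2 * x)⌋ : ℤ) else 1 - x

/-- The central tiles of `Δ_s`: for `s > 1/2` the single octagon `F₁ ∩ F₂`; for
`s ≤ 1/2` the squares of the grid generated by the square `F₁ ∩ F₂` that lie in `X_s`. -/
def centralTiles (s : ℝ) : Set (Set (ℝ × ℝ)) :=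
  if 1 / 2 < s then {F1 s ∩ F2 s}
  else {T | (∃ m n : ℤ,
        T = (fun p : ℝ × ℝ => (p.1 + 2 * s * m, p.2 + 2 * s * n)) '' (F1 s ∩ F2 s)) ∧
      T ⊆ F1 s}

/-- The portion of a set `S ⊆ X_s` lying to the left of the central tiles of `Δ_s`
(the closure of the set of points of `S` lying strictly to the left of every point of
every central tile). -/
def leftPart (s : ℝ) (S : Set (ℝ × ℝ)) : Set (ℝ × ℝ) :=
  closure {p ∈ S | ∀ T ∈ centralTiles s, ∀ q ∈ T, p.1 < q.1}

/-- `X_s⁰`, the left half of `X_s`. -/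
def Xzero (s : ℝ) : Set (ℝ × ℝ) := leftPart s (F1 s)

/-- `S_s = Λ̂_s ∩ X_s⁰`, the left half of the limit set. -/
def leftLimitSet (s : ℝ) : Set (ℝ × ℝ) := limitSet s ∩ Xzero s

/-- Dot product in the plane. -/
def dot2 (v w : ℝ × ℝ) : ℝ := v.1 * w.1 + v.2 * w.2

/-- Cross product (signed area form) in the plane. -/
def cross2 (v w : ℝ × ℝ) : ℝ := v.1 * w.2 - v.2 * w.1

/-- The Euclidean distance on `ℝ × ℝ`. -/
def eudist (p q : ℝ × ℝ) : ℝ := Real.sqrt ((p.1 - q.1) ^ 2 + (p.2 - q.2) ^ 2)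

/-- A (solid) square in the plane. -/
def IsSquareSet (P : Set (ℝ × ℝ)) : Prop :=
  ∃ p v w : ℝ × ℝ, dot2 v w = 0 ∧ dot2 v v = dot2 w w ∧ v ≠ 0 ∧
    P = {q | ∃ a b : ℝ, a ∈ Icc (0:ℝ) 1 ∧ b ∈ Icc (0:ℝ) 1 ∧ q = p + a • v + b • w}

/-- Rotation by `π/4` about the origin. -/
def rot45 (v : ℝ × ℝ) : ℝ × ℝ :=
  ((v.1 - v.2) / Real.sqrt 2, (v.1 + v.2) / Real.sqrt 2)

/-- A (solid) semi-regular octagon: a convex octagon whose interior angles all equal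
`3π/4` (so consecutive edge directions differ by rotation by `π/4`) and whose side
lengths alternate between two values `a` and `b`. -/
def IsSemiregularOctagon (P : Set (ℝ × ℝ)) : Prop :=
  ∃ (p u : ℝ × ℝ) (a b : ℝ), dot2 u u = 1 ∧ 0 < a ∧ 0 < b ∧
    P = convexHull ℝ (Set.range fun k : Fin 8 =>
      p + ∑ i ∈ Finset.range k.1, (if Even i then a else b) • rot45^[i] u)

/-- A box: a square with sides parallel to the coordinate axes. -/
def IsBox (P : Set (ℝ × ℝ)) : Prop :=
  ∃ (p : ℝ × ℝ) (c : ℝ), 0 < c ∧ P = Icc p (p + (c, c))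

/-- A diamond: a square whose sides have slope `±1`. -/
def IsDiamond (P : Set (ℝ × ℝ)) : Prop :=
  ∃ (p : ℝ × ℝ) (c : ℝ), 0 < c ∧
    P = convexHull ℝ {p + (c, 0), p - (c, 0), p + (0, c), p - (0, c)}

/-- The horizontal fundamental line of symmetry `H : y = 0`. -/
def lineH : Set (ℝ × ℝ) := {p | p.2 = 0}

/-- The vertical fundamental line of symmetry `V : x = −1`. -/
def lineV : Set (ℝ × ℝ) := {p | p.1 = -1}

/-- The fundamental line of symmetry `D_s`, of slope `−1` through `(−s,−s)`. -/
def lineD (s : ℝ) : Set (ℝ × ℝ) := {p | p.1 + p.2 = -2 * s}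

/-- The fundamental line of symmetry `E_s`: for `s ≤ 1/2` the line of slope `−1`
through `(−3s,−3s)`, for `s > 1/2` the line of slope `1` through `(−s,−s)`. -/
def lineE (s : ℝ) : Set (ℝ × ℝ) :=
  if s ≤ 1 / 2 then {p | p.1 + p.2 = -6 * s} else {p | p.2 = p.1}


/-! ### Coordinates for the domains and the steps of the map -/

/-- The open parallelogram underlying `F₁(s)`. -/
def openF1 (s : ℝ) : Set (ℝ × ℝ) := {p | |p.2| < s ∧ |p.1 - p.2| < 1}

/-- The open parallelogram underlying `F₂(s)`. -/
def openF2 (s : ℝ) : Set (ℝ × ℝ) := {p | |p.1| < s ∧ |p.1 + p.2| < 1}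

lemma mem_F1_iff {s : ℝ} (hs : 0 < s) (p : ℝ × ℝ) : p ∈ F1 s ↔ |p.2| ≤ s ∧ |p.1 - p.2| ≤ 1 := by
  obtain ⟨x, y⟩ := p
  simp only [F1, mem_ofPred_eq, mem_Icc, Prod.mk.injEq, abs_le]
  constructor
  · rintro ⟨a, b, ⟨ha, ha'⟩, ⟨hb, hb'⟩, rfl, rfl⟩
    refine ⟨⟨?_, ?_⟩, ?_, ?_⟩ <;> nlinarith
  · rintro ⟨⟨h1, h2⟩, h3, h4⟩
    refine ⟨(x - y) / 2, y / (2 * s), ⟨by linarith, by linarith⟩, ⟨?_, ?_⟩, ?_, ?_⟩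
    · rw [le_div_iff₀ (by positivity)]; linarith
    · rw [div_le_iff₀ (by positivity)]; linarith
    · field_simp; ring
    · field_simp

lemma mem_F2_iff {s : ℝ} (hs : 0 < s) (p : ℝ × ℝ) : p ∈ F2 s ↔ |p.1| ≤ s ∧ |p.1 + p.2| ≤ 1 := by
  obtain ⟨x, y⟩ := p
  have h : (x, y) ∈ F2 s ↔ (y, -x) ∈ F1 s := by
    simp only [F2, mem_image, rotQ, Prod.mk.injEq, Prod.exists]
    constructor
    · rintro ⟨a, b, hab, rfl, rfl⟩
      simpa using hab
    · intro h
      exact ⟨_, _, h, by ring, rfl⟩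
  rw [h, mem_F1_iff hs]
  simp only [abs_neg, sub_neg_eq_add, add_comm]

lemma openF1_subset {s : ℝ} (hs : 0 < s) : openF1 s ⊆ F1 s := fun p hp =>
  (mem_F1_iff hs p).2 ⟨hp.1.le, hp.2.le⟩

lemma openF2_subset {s : ℝ} (hs : 0 < s) : openF2 s ⊆ F2 s := fun p hp =>
  (mem_F2_iff hs p).2 ⟨hp.1.le, hp.2.le⟩

/-- The vector of `ℤ[s]²` with the given integer coordinates. -/
def zvec (u : ℤ × ℤ × ℤ × ℤ) (s : ℝ) : ℝ × ℝ :=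
  (u.1 + u.2.1 * s, u.2.2.1 + u.2.2.2 * s)

lemma zvec_add (u v : ℤ × ℤ × ℤ × ℤ) (s : ℝ) : zvec (u + v) s = zvec u s + zvec v s := by
  ext <;> simp [zvec] <;> ring

lemma zvec_zero (s : ℝ) : zvec 0 s = 0 := by
  ext <;> simp [zvec]

lemma zvec_eq_zero {s : ℝ} (hs : Irrational s) {u : ℤ × ℤ × ℤ × ℤ} (h : zvec u s = 0) : u = 0 := by
  have key : ∀ a b : ℤ, (a : ℝ) + b * s = 0 → a = 0 ∧ b = 0 := by
    intro a b hab
    by_cases hb : b = 0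
    · subst hb
      simp at hab
      exact ⟨hab, rfl⟩
    · exact absurd (by push_cast; linarith : (b : ℝ) * s = ((-a : ℤ) : ℝ)) ((hs.intCast_mul hb).ne_int _)
  obtain ⟨a, b, c, d⟩ := u
  simp only [zvec, Prod.mk_eq_zero] at h
  obtain ⟨rfl, rfl⟩ := key _ _ h.1
  obtain ⟨rfl, rfl⟩ := key _ _ h.2
  rfl

/-- Integer coordinates of the element of `L₂` with coefficients `a`. -/
def latTwo (a : ℤ × ℤ) : ℤ × ℤ × ℤ × ℤ := (2 * a.1, 2 * a.2, 0, -(2 * a.2))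

/-- Integer coordinates of the element of `L₁` with coefficients `a`. -/
def latOne (a : ℤ × ℤ) : ℤ × ℤ × ℤ × ℤ := (0, 2 * a.2, 2 * a.1, 2 * a.2)

lemma mem_L2_iff (s : ℝ) (v : ℝ × ℝ) : v ∈ L2 s ↔ ∃ a, v = zvec (latTwo a) s := by
  simp only [L2, mem_ofPred_eq, Prod.exists, zvec, latTwo]
  refine exists_congr fun m => exists_congr fun n => ?_
  push_cast
  ring_nf

lemma mem_L1_iff (s : ℝ) (v : ℝ × ℝ) : v ∈ L1 s ↔ ∃ a, v = zvec (latOne a) s := by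
  simp only [L1, mem_ofPred_eq, Prod.exists, zvec, latOne]
  refine exists_congr fun m => exists_congr fun n => ?_
  push_cast
  ring_nf

lemma int_eq_zero_of_abs_mul_lt {c : ℝ} {n : ℤ} (h : |c * n| < c) : n = 0 := by
  by_contra hn
  have h1 : (1 : ℝ) ≤ |(n : ℝ)| := by exact_mod_cast Int.one_le_abs hn
  have hc : 0 < c := lt_of_le_of_lt (abs_nonneg _) h
  rw [abs_mul, abs_of_pos hc] at h
  nlinarith

lemma latTwo_zero_of_F2 {s : ℝ} {p : ℝ × ℝ} {a : ℤ × ℤ} (hp : |p.1| ≤ s ∧ |p.1 + p.2| ≤ 1)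
    (hq : p + zvec (latTwo a) s ∈ openF2 s) : a = 0 := by
  obtain ⟨m, n⟩ := a
  obtain ⟨x, y⟩ := p
  simp only [openF2, zvec, latTwo, mem_ofPred_eq, Prod.mk_add_mk, abs_lt, abs_le] at hp hq
  push_cast at hq
  have hm : m = 0 := int_eq_zero_of_abs_mul_lt (c := 2) (by rw [abs_lt]; constructor <;> linarith)
  subst hm
  have hn : n = 0 := int_eq_zero_of_abs_mul_lt (c := 2 * s) (by
    push_cast at hq
    rw [abs_lt]; constructor <;> linarith)
  subst hn
  rfl

lemma latOne_zero_of_F1 {s : ℝ} {p : ℝ × ℝ} {a : ℤ × ℤ} (hp : |p.2| ≤ s ∧ |p.1 - p.2| ≤ 1)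
    (hq : p + zvec (latOne a) s ∈ openF1 s) : a = 0 := by
  obtain ⟨m, n⟩ := a
  obtain ⟨x, y⟩ := p
  simp only [openF1, zvec, latOne, mem_ofPred_eq, Prod.mk_add_mk, abs_lt, abs_le] at hp hq
  push_cast at hq
  have hm : m = 0 := int_eq_zero_of_abs_mul_lt (c := 2) (by rw [abs_lt]; constructor <;> linarith)
  subst hm
  have hn : n = 0 := int_eq_zero_of_abs_mul_lt (c := 2 * s) (by
    push_cast at hq
    rw [abs_lt]; constructor <;> linarith)
  subst hn
  rfl

lemma latTwo_add (a b : ℤ × ℤ) : latTwo (a + b) = latTwo a + latTwo b := by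
  ext <;> simp [latTwo] <;> ring

lemma latTwo_sub (a b : ℤ × ℤ) : latTwo (a - b) = latTwo a - latTwo b := by
  ext <;> simp [latTwo] <;> ring

lemma latOne_add (a b : ℤ × ℤ) : latOne (a + b) = latOne a + latOne b := by
  ext <;> simp [latOne] <;> ring

lemma latOne_sub (a b : ℤ × ℤ) : latOne (a - b) = latOne a - latOne b := by
  ext <;> simp [latOne] <;> ring

lemma zvec_sub (u v : ℤ × ℤ × ℤ × ℤ) (s : ℝ) : zvec (u - v) s = zvec u s - zvec v s := by
  ext <;> simp [zvec] <;> ring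

lemma latTwo_unique {s : ℝ} {p : ℝ × ℝ} {a b : ℤ × ℤ}
    (ha : |(p + zvec (latTwo a) s).1| ≤ s ∧
      |(p + zvec (latTwo a) s).1 + (p + zvec (latTwo a) s).2| ≤ 1)
    (hb : p + zvec (latTwo b) s ∈ openF2 s) : b = a := by
  refine sub_eq_zero.1 (latTwo_zero_of_F2 ha ?_)
  rw [latTwo_sub, zvec_sub]
  convert hb using 1
  abel

lemma latOne_unique {s : ℝ} {p : ℝ × ℝ} {a b : ℤ × ℤ}
    (ha : |(p + zvec (latOne a) s).2| ≤ s ∧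
      |(p + zvec (latOne a) s).1 - (p + zvec (latOne a) s).2| ≤ 1)
    (hb : p + zvec (latOne b) s ∈ openF1 s) : b = a := by
  refine sub_eq_zero.1 (latOne_zero_of_F1 ha ?_)
  rw [latOne_sub, zvec_sub]
  convert hb using 1
  abel

lemma exists_int_abs_add_le {s : ℝ} (hs : 0 < s) (t : ℝ) : ∃ n : ℤ, |t + 2 * s * n| ≤ s := by
  refine ⟨-round (t / (2 * s)), ?_⟩
  have h := abs_sub_round (t / (2 * s))
  have e : t + 2 * s * ((-round (t / (2 * s)) : ℤ) : ℝ)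
      = 2 * s * (t / (2 * s) - round (t / (2 * s))) := by
    push_cast; field_simp; ring
  rw [e, abs_mul, abs_of_pos (by positivity : (0 : ℝ) < 2 * s)]
  nlinarith

lemma exists_latTwo_ne_zero {s : ℝ} (hs : 0 < s) {p : ℝ × ℝ} (hp : p ∈ F2 s)
    (hn : p ∉ openF2 s) : ∃ a, zvec (latTwo a) s ≠ 0 ∧ p + zvec (latTwo a) s ∈ F2 s := by
  obtain ⟨x, y⟩ := p
  simp only [mem_F2_iff hs, openF2, mem_ofPred_eq, zvec, latTwo, ne_eq, Prod.mk_eq_zero,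
    Prod.mk_add_mk] at hp hn ⊢
  obtain ⟨h1, h2⟩ := hp
  by_cases h : |x| < s
  · have h3 : |x + y| = 1 := le_antisymm h2 (by by_contra hc; exact hn ⟨h, not_le.1 hc⟩)
    have key : ∀ m : ℤ, m ≠ 0 → |x + y + 2 * m| ≤ 1 → ∃ a : ℤ × ℤ,
      ¬(((2 * a.1 : ℤ) : ℝ) + ((2 * a.2 : ℤ) : ℝ) * s = 0 ∧
        ((0 : ℤ) : ℝ) + ((-(2 * a.2) : ℤ) : ℝ) * s = 0) ∧
        |x + (((2 * a.1 : ℤ) : ℝ) + ((2 * a.2 : ℤ) : ℝ) * s)| ≤ s ∧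
        |x + (((2 * a.1 : ℤ) : ℝ) + ((2 * a.2 : ℤ) : ℝ) * s) +
          (y + (((0 : ℤ) : ℝ) + ((-(2 * a.2) : ℤ) : ℝ) * s))| ≤ 1 := by
      intro m hm hm2
      obtain ⟨n, hn⟩ := exists_int_abs_add_le hs (x + 2 * m)
      refine ⟨(m, n), ?_, ?_, ?_⟩
      · rintro ⟨e1, e2⟩
        push_cast at e1 e2
        apply hm
        have : (m : ℝ) = 0 := by linarith
        exact_mod_cast this
      · convert hn using 2; push_cast; ring
      · convert hm2 using 2; push_cast; ring
    rcases eq_or_eq_neg_of_abs_eq h3 with h4 | h4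
    · exact key (-1) (by norm_num) (by rw [h4]; norm_num)
    · exact key 1 (by norm_num) (by rw [h4]; norm_num)
  · have h3 : |x| = s := le_antisymm h1 (not_lt.1 h)
    have key : ∀ n : ℤ, n ≠ 0 → |x + 2 * s * n| ≤ s → ∃ a : ℤ × ℤ,
      ¬(((2 * a.1 : ℤ) : ℝ) + ((2 * a.2 : ℤ) : ℝ) * s = 0 ∧
        ((0 : ℤ) : ℝ) + ((-(2 * a.2) : ℤ) : ℝ) * s = 0) ∧
        |x + (((2 * a.1 : ℤ) : ℝ) + ((2 * a.2 : ℤ) : ℝ) * s)| ≤ s ∧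
        |x + (((2 * a.1 : ℤ) : ℝ) + ((2 * a.2 : ℤ) : ℝ) * s) +
          (y + (((0 : ℤ) : ℝ) + ((-(2 * a.2) : ℤ) : ℝ) * s))| ≤ 1 := by
      intro n hn hn2
      refine ⟨(0, n), ?_, ?_, ?_⟩
      · rintro ⟨e1, e2⟩
        push_cast at e1
        have : (n : ℝ) * s = 0 := by linarith
        rcases mul_eq_zero.1 this with h5 | h5
        · exact hn (by exact_mod_cast h5)
        · exact hs.ne' h5
      · convert hn2 using 2; push_cast; ring
      · convert h2 using 2; push_cast; ring
    rcases eq_or_eq_neg_of_abs_eq h3 with h4 | h4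
    · exact key (-1) (by norm_num) (by rw [h4, abs_le]; push_cast; constructor <;> linarith)
    · exact key 1 (by norm_num) (by rw [h4, abs_le]; push_cast; constructor <;> linarith)

lemma exists_latOne_ne_zero {s : ℝ} (hs : 0 < s) {p : ℝ × ℝ} (hp : p ∈ F1 s)
    (hn : p ∉ openF1 s) : ∃ a, zvec (latOne a) s ≠ 0 ∧ p + zvec (latOne a) s ∈ F1 s := by
  have hp2 : (-p.2, p.1) ∈ F2 s := by
    rw [mem_F1_iff hs] at hp
    rw [mem_F2_iff hs]
    exact ⟨by simpa using hp.1, by simpa [add_comm, ← sub_eq_add_neg] using hp.2⟩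
  have hn2 : (-p.2, p.1) ∉ openF2 s := fun h => hn
    ⟨by simpa using h.1, by simpa [add_comm, ← sub_eq_add_neg] using h.2⟩
  obtain ⟨⟨m, n⟩, h1, h2⟩ := exists_latTwo_ne_zero hs hp2 hn2
  refine ⟨(-m, -n), fun h => h1 ?_, ?_⟩
  · simp only [zvec, latOne, latTwo, Prod.mk_eq_zero] at h ⊢
    push_cast at h ⊢
    exact ⟨by linarith [h.2], by linarith [h.1]⟩
  · rw [mem_F2_iff hs] at h2
    rw [mem_F1_iff hs]
    simp only [zvec, latOne, latTwo, Prod.fst_add, Prod.snd_add] at h2 ⊢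
    push_cast at h2 ⊢
    refine ⟨?_, ?_⟩
    · rw [← abs_neg]; convert h2.1 using 2; ring
    · convert h2.2 using 2; ring

lemma stepRel_iff {s : ℝ} (hs : 0 < s) (p q : ℝ × ℝ) : StepRel s p q ↔
    (p ∈ F1 s ∧ ∃ a, q = p + zvec (latTwo a) s ∧ q ∈ openF2 s) ∨
    (p ∈ F2 s ∧ ∃ a, q = p + zvec (latOne a) s ∧ q ∈ openF1 s) := by
  have e1 : (1 : Fin 2) + 1 = 0 := rfl
  simp only [StepRel, Fin.exists_fin_two, FF, LL, if_true, zero_add, one_ne_zero, if_false, e1]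
  refine or_congr (and_congr_right fun _ => ?_) (and_congr_right fun _ => ?_)
  · constructor
    · rintro ⟨hu, h1, h2⟩
      obtain ⟨a, ha⟩ := (mem_L2_iff _ _).1 h1
      refine ⟨a, by rw [← ha]; abel, ?_⟩
      by_contra hc
      obtain ⟨b, hb, hb2⟩ := exists_latTwo_ne_zero hs h2 hc
      have h3 := hu.unique (y₁ := q - p) (y₂ := q - p + zvec (latTwo b) s)
        ⟨h1, by simpa using h2⟩
        ⟨(mem_L2_iff _ _).2 ⟨a + b, by rw [latTwo_add, zvec_add, ha]⟩, by
          convert hb2 using 1; abel⟩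
      exact hb (by simpa using h3)
    · rintro ⟨a, rfl, h⟩
      refine ⟨⟨zvec (latTwo a) s, ⟨(mem_L2_iff _ _).2 ⟨a, rfl⟩, openF2_subset hs h⟩, ?_⟩,
        by simpa using (mem_L2_iff _ _).2 ⟨a, rfl⟩, openF2_subset hs h⟩
      rintro v ⟨hv, hv2⟩
      obtain ⟨b, rfl⟩ := (mem_L2_iff _ _).1 hv
      rw [latTwo_unique ((mem_F2_iff hs _).1 hv2) h]
  · constructor
    · rintro ⟨hu, h1, h2⟩
      obtain ⟨a, ha⟩ := (mem_L1_iff _ _).1 h1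
      refine ⟨a, by rw [← ha]; abel, ?_⟩
      by_contra hc
      obtain ⟨b, hb, hb2⟩ := exists_latOne_ne_zero hs h2 hc
      have h3 := hu.unique (y₁ := q - p) (y₂ := q - p + zvec (latOne b) s)
        ⟨h1, by simpa using h2⟩
        ⟨(mem_L1_iff _ _).2 ⟨a + b, by rw [latOne_add, zvec_add, ha]⟩, by
          convert hb2 using 1; abel⟩
      exact hb (by simpa using h3)
    · rintro ⟨a, rfl, h⟩
      refine ⟨⟨zvec (latOne a) s, ⟨(mem_L1_iff _ _).2 ⟨a, rfl⟩, openF1_subset hs h⟩, ?_⟩,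
        by simpa using (mem_L1_iff _ _).2 ⟨a, rfl⟩, openF1_subset hs h⟩
      rintro v ⟨hv, hv2⟩
      obtain ⟨b, rfl⟩ := (mem_L1_iff _ _).1 hv
      rw [latOne_unique ((mem_F1_iff hs _).1 hv2) h]

lemma stepRel_eq_of_mem_inter {s : ℝ} (hs : 0 < s) {p q : ℝ × ℝ} (h1 : p ∈ F1 s) (h2 : p ∈ F2 s)
    (h : StepRel s p q) : q = p := by
  rcases (stepRel_iff hs p q).1 h with ⟨-, a, rfl, ha⟩ | ⟨-, a, rfl, ha⟩
  · rw [latTwo_zero_of_F2 ((mem_F2_iff hs p).1 h2) ha]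
    simp [latTwo, zvec]
  · rw [latOne_zero_of_F1 ((mem_F1_iff hs p).1 h1) ha]
    simp [latOne, zvec]

lemma mapRel_eq_of_mem_inter {s : ℝ} (hs : 0 < s) {p q : ℝ × ℝ} (h1 : p ∈ F1 s) (h2 : p ∈ F2 s)
    (h : MapRel s p q) : q = p := by
  obtain ⟨r, hr, hq⟩ := h
  obtain rfl := stepRel_eq_of_mem_inter hs h1 h2 hr
  exact stepRel_eq_of_mem_inter hs h1 h2 hq

lemma iterRel_self_of_mem {s : ℝ} (hs : 0 < s) {p : ℝ × ℝ} (h1 : p ∈ openF1 s) (h2 : p ∈ F2 s)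
    (n : ℕ) : IterRel s n p p := by
  have h : StepRel s p p := (stepRel_iff hs p p).2 (Or.inr ⟨h2, 0, by simp [zvec, latOne], h1⟩)
  induction n with
  | zero => rfl
  | succ n ih => exact ⟨p, ih, p, h, h⟩


/-! ### Orbits as integer codes -/

/-- The integer data of one application of `f_s`: the coefficients of the two translations. -/
abbrev Letter := (ℤ × ℤ) × (ℤ × ℤ)

/-- Integer coordinates of the translation effected by a letter. -/
def letterDisp (a : Letter) : ℤ × ℤ × ℤ × ℤ := latTwo a.1 + latOne a.2

/-- Total translation of the first `t` letters of a code. -/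
def disp (α : ℕ → Letter) (t : ℕ) : ℤ × ℤ × ℤ × ℤ := ∑ i ∈ Finset.range t, letterDisp (α i)

/-- The letter `a` describes the action of `f_s` at `p`, and both images are interior points. -/
def StrictStep (s : ℝ) (a : Letter) (p : ℝ × ℝ) : Prop :=
  p + zvec (latTwo a.1) s ∈ openF2 s ∧ p + zvec (letterDisp a) s ∈ openF1 s

/-- The code `α` describes the whole forward orbit of `p`. -/
def Follows (s : ℝ) (α : ℕ → Letter) (p : ℝ × ℝ) : Prop :=
  ∀ t, StrictStep s (α t) (p + zvec (disp α t) s)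

lemma disp_zero (α : ℕ → Letter) : disp α 0 = 0 := by simp [disp]

lemma disp_succ (α : ℕ → Letter) (t : ℕ) : disp α (t + 1) = disp α t + letterDisp (α t) := by
  simp [disp, Finset.sum_range_succ]

lemma disp_add (α : ℕ → Letter) (e t : ℕ) :
    disp α (e + t) = disp α e + disp (fun i => α (e + i)) t := by
  simp [disp, Finset.sum_range_add]

lemma disp_mul_of_periodic {α : ℕ → Letter} {e : ℕ} (h : ∀ t, α (e + t) = α t) (l : ℕ) :
    disp α (l * e) = l • disp α e := by
  induction l with
  | zero => simp [disp_zero]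
  | succ l ih =>
    have : disp (fun i => α (e + i)) (l * e) = disp α (l * e) := by simp only [h]
    rw [show (l + 1) * e = e + l * e by ring, disp_add, this, ih, succ_nsmul']

lemma zvec_nsmul (n : ℕ) (u : ℤ × ℤ × ℤ × ℤ) (s : ℝ) : zvec (n • u) s = (n : ℝ) • zvec u s := by
  ext <;> simp [zvec] <;> ring

lemma StrictStep.unique {s : ℝ} (hs : 0 < s) {a b : Letter} {p : ℝ × ℝ}
    (ha : StrictStep s a p) (hb : StrictStep s b p) : a = b := by
  obtain ⟨a1, a2⟩ := a
  obtain ⟨b1, b2⟩ := b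
  have h1 : a1 = b1 := latTwo_unique ((mem_F2_iff hs _).1 (openF2_subset hs hb.1)) ha.1
  subst h1
  have h2 := ha.2
  have h3 := hb.2
  simp only [letterDisp, zvec_add, ← add_assoc] at h2 h3
  rw [latOne_unique ((mem_F1_iff hs _).1 (openF1_subset hs h3)) h2]

lemma StrictStep.mapRel {s : ℝ} (hs : 0 < s) {a : Letter} {p : ℝ × ℝ} (hp : p ∈ F1 s)
    (ha : StrictStep s a p) : MapRel s p (p + zvec (letterDisp a) s) := by
  refine ⟨p + zvec (latTwo a.1) s, (stepRel_iff hs _ _).2 (Or.inl ⟨hp, a.1, rfl, ha.1⟩),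
    (stepRel_iff hs _ _).2 (Or.inr ⟨openF2_subset hs ha.1, a.2, ?_, ha.2⟩)⟩
  rw [letterDisp, zvec_add, add_assoc]

lemma iterRel_of_strictStep {s : ℝ} (hs : 0 < s) {α : ℕ → Letter} {p : ℝ × ℝ} (hp : p ∈ F1 s)
    (n : ℕ) (h : ∀ t < n, StrictStep s (α t) (p + zvec (disp α t) s)) :
    IterRel s n p (p + zvec (disp α n) s) ∧ p + zvec (disp α n) s ∈ F1 s := by
  induction n with
  | zero => simpa [disp_zero, zvec_zero, IterRel] using hp
  | succ n ih =>
    obtain ⟨h1, h2⟩ := ih fun t ht => h t (ht.trans n.lt_succ_self)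
    have h3 := h n n.lt_succ_self
    rw [disp_succ, zvec_add, ← add_assoc]
    exact ⟨⟨_, h1, h3.mapRel hs h2⟩, openF1_subset hs h3.2⟩

lemma code_unique {s : ℝ} (hs : 0 < s) {α β : ℕ → Letter} {p : ℝ × ℝ} {n : ℕ}
    (hα : ∀ t < n, StrictStep s (α t) (p + zvec (disp α t) s))
    (hβ : ∀ t < n, StrictStep s (β t) (p + zvec (disp β t) s)) : ∀ t < n, α t = β t := by
  intro t
  induction t using Nat.strong_induction_on with
  | _ t ih =>
    intro ht
    have : disp α t = disp β t := Finset.sum_congr rfl fun i hi => by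
      have hi := Finset.mem_range.1 hi
      rw [ih i hi (hi.trans ht)]
    have h := hα t ht
    rw [this] at h
    exact h.unique hs (hβ t ht)

lemma Follows.unique {s : ℝ} (hs : 0 < s) {α β : ℕ → Letter} {p : ℝ × ℝ}
    (hα : Follows s α p) (hβ : Follows s β p) : α = β :=
  funext fun t => code_unique hs (n := t + 1) (fun t _ => hα t) (fun t _ => hβ t) t t.lt_succ_self

lemma Follows.shift {s : ℝ} {α : ℕ → Letter} {p : ℝ × ℝ} (hα : Follows s α p) (e : ℕ) :
    Follows s (fun i => α (e + i)) (p + zvec (disp α e) s) := by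
  intro t
  have := hα (e + t)
  rwa [disp_add, zvec_add, ← add_assoc] at this

lemma Follows.mem_openF1 {s : ℝ} {α : ℕ → Letter} {p : ℝ × ℝ} (hα : Follows s α p)
    (hp : p ∈ openF1 s) (t : ℕ) : p + zvec (disp α t) s ∈ openF1 s := by
  cases t with
  | zero => simpa [disp_zero, zvec_zero] using hp
  | succ t =>
    have := (hα t).2
    rwa [add_assoc, ← zvec_add, ← disp_succ] at this

lemma exists_strictStep_of_mapRel {s : ℝ} (hs : 0 < s) {p q : ℝ × ℝ} (hp : p ∈ openF1 s)
    (hp2 : p ∈ F2 s → p ∈ openF2 s) (h : MapRel s p q)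
    (hq : q ∈ F1 s → q ∈ F2 s → q ∈ openF1 s ∧ q ∈ openF2 s) :
    ∃ a, StrictStep s a p ∧ q = p + zvec (letterDisp a) s := by
  have h0 : letterDisp 0 = 0 := rfl
  have h00 : latTwo 0 = 0 := rfl
  by_cases hp3 : p ∈ F2 s
  · rw [mapRel_eq_of_mem_inter hs (openF1_subset hs hp) hp3 h]
    exact ⟨0, by simpa [StrictStep, h0, h00, zvec_zero] using ⟨hp2 hp3, hp⟩,
      by simp [h0, zvec_zero]⟩
  · obtain ⟨r, hr, hq2⟩ := h
    rcases (stepRel_iff hs p r).1 hr with ⟨-, a, rfl, ha⟩ | ⟨h3, -⟩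
    · rcases (stepRel_iff hs _ q).1 hq2 with ⟨h4, -⟩ | ⟨-, b, rfl, hb⟩
      · obtain rfl := stepRel_eq_of_mem_inter hs h4 (openF2_subset hs ha) hq2
        have e : letterDisp (a, 0) = latTwo a := by simp [letterDisp, latOne, latTwo]
        refine ⟨(a, 0), ⟨ha, ?_⟩, by rw [e]⟩
        rw [e]
        exact (hq h4 (openF2_subset hs ha)).1
      · have e : p + zvec (latTwo a) s + zvec (latOne b) s = p + zvec (letterDisp (a, b)) s := by
          rw [letterDisp, zvec_add, add_assoc]
        exact ⟨(a, b), ⟨ha, e ▸ hb⟩, e⟩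
    · exact absurd h3 hp3

open Classical in
/-- The letter describing the action at `p`, with value `0` if there is none. -/
def letterAt (s : ℝ) (p : ℝ × ℝ) : Letter :=
  if h : ∃ a, StrictStep s a p then h.choose else 0

/-- The total function extending the strict steps of `f_s`. -/
def strictMap (s : ℝ) (p : ℝ × ℝ) : ℝ × ℝ := p + zvec (letterDisp (letterAt s p)) s

lemma letterAt_eq {s : ℝ} (hs : 0 < s) {a : Letter} {p : ℝ × ℝ} (h : StrictStep s a p) :
    letterAt s p = a := by
  have h1 : ∃ a, StrictStep s a p := ⟨a, h⟩
  rw [letterAt, dif_pos h1]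
  exact h1.choose_spec.unique hs h

lemma iterate_strictMap {s : ℝ} (hs : 0 < s) {p : ℝ × ℝ} (hp : p ∈ openF1 s) :
    ∀ (n : ℕ) (q : ℝ × ℝ), IterRel s n p q →
      (q ∈ F1 s → q ∈ F2 s → q ∈ openF1 s ∧ q ∈ openF2 s) →
      q = (strictMap s)^[n] p ∧ q ∈ openF1 s ∧
        ∀ t < n, StrictStep s (letterAt s ((strictMap s)^[t] p)) ((strictMap s)^[t] p) := by
  intro n
  induction n with
  | zero =>
    rintro q rfl -
    exact ⟨rfl, hp, fun t ht => absurd ht t.not_lt_zero⟩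
  | succ n ih =>
    rintro q ⟨r, hr, hq⟩ hok
    have hrok : r ∈ F1 s → r ∈ F2 s → r ∈ openF1 s ∧ r ∈ openF2 s := by
      intro h1 h2
      obtain rfl := mapRel_eq_of_mem_inter hs h1 h2 hq
      exact hok h1 h2
    obtain ⟨rfl, h2, h3⟩ := ih r hr hrok
    obtain ⟨a, ha, rfl⟩ := exists_strictStep_of_mapRel hs h2
      (fun h => (hrok (openF1_subset hs h2) h).2) hq hok
    refine ⟨?_, ha.2, fun t ht => ?_⟩
    · rw [Function.iterate_succ_apply', strictMap, letterAt_eq hs ha]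
    · rcases Nat.lt_succ_iff_lt_or_eq.1 ht with h | rfl
      · exact h3 t h
      · rwa [letterAt_eq hs ha]

lemma exists_follows {s : ℝ} (hs : 0 < s) {p : ℝ × ℝ} (hp : p ∈ openF1 s) (hp2 : p ∉ F2 s)
    {N : ℕ} (hN : 0 < N) (h : IterRel s N p p) :
    ∃ α, Follows s α p ∧ zvec (disp α N) s = 0 := by
  obtain ⟨h1, -, h3⟩ := iterate_strictMap hs hp N p h fun _ h => absurd h hp2
  have hper : Function.IsPeriodicPt (strictMap s) N p := h1.symm
  let α : ℕ → Letter := fun t => letterAt s ((strictMap s)^[t] p)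
  have hD : ∀ t, p + zvec (disp α t) s = (strictMap s)^[t] p := by
    intro t
    induction t with
    | zero => simp [disp_zero, zvec_zero]
    | succ t ih =>
      rw [disp_succ, zvec_add, ← add_assoc, ih, Function.iterate_succ_apply']
      rfl
  refine ⟨α, fun t => ?_, ?_⟩
  · rw [hD]
    have := h3 (t % N) (Nat.mod_lt _ hN)
    rwa [hper.iterate_mod_apply] at this
  · have := hD N
    rw [← h1] at this
    simpa using this

lemma isOpen_openF1 (s : ℝ) : IsOpen (openF1 s) := by
  have h1 : IsOpen {p : ℝ × ℝ | |p.2| < s} := isOpen_lt (by fun_prop) (by fun_prop)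
  have h2 : IsOpen {p : ℝ × ℝ | |p.1 - p.2| < 1} := isOpen_lt (by fun_prop) (by fun_prop)
  exact h1.inter h2

lemma isOpen_openF2 (s : ℝ) : IsOpen (openF2 s) := by
  have h1 : IsOpen {p : ℝ × ℝ | |p.1| < s} := isOpen_lt (by fun_prop) (by fun_prop)
  have h2 : IsOpen {p : ℝ × ℝ | |p.1 + p.2| < 1} := isOpen_lt (by fun_prop) (by fun_prop)
  exact h1.inter h2

lemma eventually_strictStep {s : ℝ} {a : Letter} {p c : ℝ × ℝ} (h : StrictStep s a (p + c)) :
    ∀ᶠ q in 𝓝 p, StrictStep s a (q + c) := by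
  refine Filter.Eventually.and ?_ ?_
  · have hc : Continuous fun q : ℝ × ℝ => q + c + zvec (latTwo a.1) s := by fun_prop
    exact hc.continuousAt.eventually ((isOpen_openF2 s).mem_nhds h.1)
  · have hc : Continuous fun q : ℝ × ℝ => q + c + zvec (letterDisp a) s := by fun_prop
    exact hc.continuousAt.eventually ((isOpen_openF1 s).mem_nhds h.2)

lemma exists_common_code {s : ℝ} (hs : 0 < s) {A : Set (ℝ × ℝ)} (hA : IsPreconnected A)
    (h : ∀ p ∈ A, ∃ α, Follows s α p) : ∃ α, ∀ p ∈ A, Follows s α p := by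
  rcases A.eq_empty_or_nonempty with rfl | ⟨p₀, hp₀⟩
  · exact ⟨0, by simp⟩
  choose! c hc using h
  refine ⟨c p₀, fun p hp => ?_⟩
  suffices c p = c p₀ from this ▸ hc p hp
  funext t
  refine hA.constant (f := fun q => c q t) ?_ hp hp₀
  intro q hq
  have h1 : ∀ᶠ r in 𝓝 q, ∀ u ∈ Iio (t + 1),
      StrictStep s (c q u) (r + zvec (disp (c q) u) s) :=
    (eventually_all_finite (finite_Iio _)).2 fun u _ => eventually_strictStep (hc q hq u)
  have h2 : ∀ᶠ r in 𝓝[A] q, c r t = c q t := by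
    filter_upwards [nhdsWithin_le_nhds h1, self_mem_nhdsWithin] with r hr hrA
    exact code_unique hs (n := t + 1) (fun u _ => hc r hrA u) hr t t.lt_succ_self
  exact tendsto_const_nhds.congr' (h2.mono fun r hr => hr.symm)

lemma norm_le_of_mem_openF1 {s : ℝ} (hs1 : s < 1) {p : ℝ × ℝ} (hp : p ∈ openF1 s) : ‖p‖ ≤ 2 := by
  obtain ⟨h1, h2⟩ := hp
  rw [Prod.norm_def, Real.norm_eq_abs, Real.norm_eq_abs, max_le_iff, abs_le, abs_le]
  rw [abs_lt] at h1 h2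
  refine ⟨⟨?_, ?_⟩, ?_, ?_⟩ <;> linarith

lemma exists_pigeonhole_bound {ρ : ℝ} (hρ : 0 < ρ) : ∃ C : ℕ, ∀ x : ℕ → ℝ × ℝ,
    (∀ t, ‖x t‖ ≤ 2) → ∃ i j, i < j ∧ j ≤ C ∧ dist (x j) (x i) < ρ := by
  obtain ⟨T, -, hT, hcov⟩ := (isCompact_closedBall (0 : ℝ × ℝ) 2).finite_cover_balls (half_pos hρ)
  refine ⟨hT.toFinset.card, fun x hx => ?_⟩
  have h : ∀ t, ∃ c ∈ T, dist (x t) c < ρ / 2 := by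
    intro t
    have := hcov (mem_closedBall_zero_iff.2 (hx t))
    simpa using this
  choose c hc hd using h
  obtain ⟨i, hi, j, hj, hij, he⟩ := Finset.exists_ne_map_eq_of_card_lt_of_maps_to
    (s := Finset.range (hT.toFinset.card + 1)) (t := hT.toFinset) (f := c) (by simp)
    (fun t _ => by simpa using hc t)
  have hd2 : dist (x i) (x j) < ρ := by
    have h1 := hd i
    have h2 := hd j
    rw [← he] at h2
    linarith [dist_triangle_right (x i) (x j) (c i)]
  rw [Finset.mem_range, Nat.lt_succ_iff] at hi hj
  rcases lt_or_gt_of_ne hij with h | h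
  · exact ⟨i, j, h, hj, by rwa [dist_comm]⟩
  · exact ⟨j, i, h, hi, hd2⟩

lemma exists_small_period {s : ℝ} (hs : 0 < s) {A : Set (ℝ × ℝ)} {α : ℕ → Letter} {p : ℝ × ℝ}
    {N i j : ℕ} (hp : p ∈ A) (hα : ∀ q ∈ A, Follows s α q) (hN : 0 < N)
    (hD : zvec (disp α N) s = 0) (hij : i < j)
    (h : p + (zvec (disp α j) s - zvec (disp α i) s) ∈ A) : zvec (disp α (j - i)) s = 0 := by
  have hNper : ∀ t, α (N + t) = α t := by
    have h1 := (hα p hp).shift N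
    rw [hD, add_zero] at h1
    exact congrFun (h1.unique hs (hα p hp))
  have hNmul : ∀ l t, α (l * N + t) = α t := by
    intro l
    induction l with
    | zero => simp
    | succ l ih =>
      intro t
      rw [show (l + 1) * N + t = N + (l * N + t) by ring, hNper, ih]
  have h1 : ∀ t, α (i + t) = α (j + t) := by
    have h2 := (hα _ h).shift i
    rw [show p + (zvec (disp α j) s - zvec (disp α i) s) + zvec (disp α i) s
      = p + zvec (disp α j) s by abel] at h2
    exact congrFun (h2.unique hs ((hα p hp).shift j))
  have h2 : ∀ t, α ((j - i) + t) = α t := by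
    intro t
    have hi : i ≤ i * N := Nat.le_mul_of_pos_right i hN
    rw [← hNmul i t, ← hNmul i (j - i + t), show i * N + t = i + (i * N - i + t) by omega, h1]
    congr 1
    omega
  have h3 := disp_mul_of_periodic h2 N
  rw [mul_comm, disp_mul_of_periodic hNper] at h3
  have h4 := congrArg (fun u => zvec u s) h3
  simp only [zvec_nsmul, hD, smul_zero] at h4
  exact (smul_eq_zero.1 h4.symm).resolve_left (by exact_mod_cast hN.ne')

lemma exists_finite_letters {s₀ : ℝ} (hs₀ : 0 < s₀) : ∃ L : Set Letter, L.Finite ∧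
    ∀ s p a, s₀ ≤ s → s < 1 → p ∈ openF1 s → StrictStep s a p → a ∈ L := by
  obtain ⟨R, hR⟩ := exists_nat_gt (3 / s₀ + 3)
  have hR1 : (3 : ℝ) < R := by have := div_pos (by norm_num : (0 : ℝ) < 3) hs₀; linarith
  have hR2 : 3 < R * s₀ := by
    rw [← div_lt_iff₀ hs₀]; linarith
  refine ⟨(Icc (-R : ℤ) R ×ˢ Icc (-R : ℤ) R) ×ˢ (Icc (-R : ℤ) R ×ˢ Icc (-R : ℤ) R),
    ((finite_Icc _ _).prod (finite_Icc _ _)).prod ((finite_Icc _ _).prod (finite_Icc _ _)), ?_⟩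
  rintro s ⟨x, y⟩ ⟨⟨m, n⟩, m', n'⟩ hs hs1 hp ⟨h2, h3⟩
  have hs0 : 0 < s := hs₀.trans_le hs
  have hRs : 3 < R * s := hR2.trans_le (mul_le_mul_of_nonneg_left hs (by positivity))
  have small : ∀ z : ℤ, |2 * s * z| ≤ 3 → z ∈ Icc (-R : ℤ) R := by
    intro z hz
    rw [abs_le] at hz
    constructor
    · have : (-R : ℝ) ≤ z := by by_contra hc; nlinarith
      exact_mod_cast this
    · have : (z : ℝ) ≤ R := by by_contra hc; nlinarith
      exact_mod_cast this
  have small2 : ∀ z : ℤ, |2 * (z : ℝ)| ≤ 6 → z ∈ Icc (-R : ℤ) R := by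
    intro z hz
    rw [abs_le] at hz
    constructor
    · have : (-R : ℝ) ≤ z := by linarith
      exact_mod_cast this
    · have : (z : ℝ) ≤ R := by linarith
      exact_mod_cast this
  simp only [openF1, openF2, letterDisp, latOne, latTwo, zvec, mem_ofPred_eq, Prod.mk_add_mk,
    abs_lt] at hp h2 h3
  push_cast at h2 h3
  refine ⟨⟨small2 _ ?_, small _ ?_⟩, small2 _ ?_, small _ ?_⟩ <;> rw [abs_le] <;>
    constructor <;> nlinarith


/-! ### Integral affine forms -/

/-- The affine form `a x + b y + c + d s` with integer coefficients `(a, b, c, d)`. -/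
def evalForm (g : ℤ × ℤ × ℤ × ℤ) (s : ℝ) (p : ℝ × ℝ) : ℝ :=
  g.1 * p.1 + g.2.1 * p.2 + (g.2.2.1 + g.2.2.2 * s)

lemma continuous_evalForm (g : ℤ × ℤ × ℤ × ℤ) :
    Continuous fun z : ℝ × (ℝ × ℝ) => evalForm g z.1 z.2 := by
  unfold evalForm; fun_prop

lemma continuous_evalForm_right (g : ℤ × ℤ × ℤ × ℤ) (s : ℝ) : Continuous (evalForm g s) :=
  (continuous_evalForm g).comp (Continuous.prodMk_right s)

/-- The forms whose positivity at `p` says that `p + zvec u s` is in the open `F₁`. -/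
def formsOne (u : ℤ × ℤ × ℤ × ℤ) : List (ℤ × ℤ × ℤ × ℤ) :=
  [(0, 1, u.2.2.1, u.2.2.2 + 1), (0, -1, -u.2.2.1, 1 - u.2.2.2),
    (1, -1, u.1 - u.2.2.1 + 1, u.2.1 - u.2.2.2), (-1, 1, u.2.2.1 - u.1 + 1, u.2.2.2 - u.2.1)]

/-- The forms whose positivity at `p` says that `p + zvec u s` is in the open `F₂`. -/
def formsTwo (u : ℤ × ℤ × ℤ × ℤ) : List (ℤ × ℤ × ℤ × ℤ) :=
  [(1, 0, u.1, u.2.1 + 1), (-1, 0, -u.1, 1 - u.2.1),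
    (1, 1, u.1 + u.2.2.1 + 1, u.2.1 + u.2.2.2), (-1, -1, 1 - u.1 - u.2.2.1, -u.2.1 - u.2.2.2)]

lemma mem_openF1_iff_forms (u : ℤ × ℤ × ℤ × ℤ) (s : ℝ) (p : ℝ × ℝ) :
    p + zvec u s ∈ openF1 s ↔ ∀ g ∈ formsOne u, 0 < evalForm g s p := by
  simp only [openF1, formsOne, evalForm, zvec, mem_ofPred_eq, List.forall_mem_cons, abs_lt,
    Prod.fst_add, Prod.snd_add]
  push_cast
  constructor
  · rintro ⟨⟨h1, h2⟩, h3, h4⟩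
    refine ⟨by linarith, by linarith, by linarith, by linarith, by simp⟩
  · rintro ⟨h1, h2, h3, h4, -⟩
    refine ⟨⟨by linarith, by linarith⟩, by linarith, by linarith⟩

lemma mem_openF2_iff_forms (u : ℤ × ℤ × ℤ × ℤ) (s : ℝ) (p : ℝ × ℝ) :
    p + zvec u s ∈ openF2 s ↔ ∀ g ∈ formsTwo u, 0 < evalForm g s p := by
  simp only [openF2, formsTwo, evalForm, zvec, mem_ofPred_eq, List.forall_mem_cons, abs_lt,
    Prod.fst_add, Prod.snd_add]
  push_cast
  constructor
  · rintro ⟨⟨h1, h2⟩, h3, h4⟩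
    refine ⟨by linarith, by linarith, by linarith, by linarith, by simp⟩
  · rintro ⟨h1, h2, h3, h4, -⟩
    refine ⟨⟨by linarith, by linarith⟩, by linarith, by linarith⟩

/-- The forms whose positivity at `p` says that the letter `a` acts at `p + zvec u s`. -/
def stepForms (a : Letter) (u : ℤ × ℤ × ℤ × ℤ) : List (ℤ × ℤ × ℤ × ℤ) :=
  formsTwo (u + latTwo a.1) ++ formsOne (u + letterDisp a)

lemma strictStep_iff_forms (a : Letter) (u : ℤ × ℤ × ℤ × ℤ) (s : ℝ) (p : ℝ × ℝ) :
    StrictStep s a (p + zvec u s) ↔ ∀ g ∈ stepForms a u, 0 < evalForm g s p := by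
  rw [StrictStep, add_assoc, add_assoc, ← zvec_add, ← zvec_add, mem_openF1_iff_forms,
    mem_openF2_iff_forms, stepForms, List.forall_mem_append]

lemma formsOne_ne_zero {u g : ℤ × ℤ × ℤ × ℤ} (hg : g ∈ formsOne u) : g.1 ≠ 0 ∨ g.2.1 ≠ 0 := by
  simp only [formsOne, List.mem_cons, List.not_mem_nil, or_false] at hg
  rcases hg with rfl | rfl | rfl | rfl <;> simp

lemma formsTwo_ne_zero {u g : ℤ × ℤ × ℤ × ℤ} (hg : g ∈ formsTwo u) : g.1 ≠ 0 ∨ g.2.1 ≠ 0 := by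
  simp only [formsTwo, List.mem_cons, List.not_mem_nil, or_false] at hg
  rcases hg with rfl | rfl | rfl | rfl <;> simp

lemma stepForms_ne_zero {a : Letter} {u g : ℤ × ℤ × ℤ × ℤ} (hg : g ∈ stepForms a u) :
    g.1 ≠ 0 ∨ g.2.1 ≠ 0 :=
  (List.mem_append.1 hg).elim formsTwo_ne_zero formsOne_ne_zero

lemma evalForm_add_smul (g : ℤ × ℤ × ℤ × ℤ) (s t : ℝ) (p d : ℝ × ℝ) :
    evalForm g s (p + t • d) = evalForm g s p + t * (g.1 * d.1 + g.2.1 * d.2) := by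
  simp [evalForm]; ring

/-- What holds near `p` holds at points `p + t • d` with `t > 0` small. -/
lemma exists_pos_of_eventually {p : ℝ × ℝ} {Q : ℝ × ℝ → Prop} (h : ∀ᶠ q in 𝓝 p, Q q)
    (d : ℝ × ℝ) : ∀ᶠ t : ℝ in 𝓝[>] 0, 0 < t ∧ Q (p + t • d) := by
  have hc : Continuous fun t : ℝ => p + t • d := by fun_prop
  have h1 : Tendsto (fun t : ℝ => p + t • d) (𝓝 0) (𝓝 p) := by
    simpa using hc.tendsto 0
  filter_upwards [self_mem_nhdsWithin, nhdsWithin_le_nhds (h1.eventually h)] with t h2 h3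
  exact ⟨h2, h3⟩

lemma evalForm_pos_of_eventually_nonneg {g : ℤ × ℤ × ℤ × ℤ} (hg : g.1 ≠ 0 ∨ g.2.1 ≠ 0) {s : ℝ}
    {p : ℝ × ℝ} (h : ∀ᶠ q in 𝓝 p, 0 ≤ evalForm g s q) : 0 < evalForm g s p := by
  obtain ⟨t, ht, h2⟩ := (exists_pos_of_eventually h (-(g.1 : ℝ), -(g.2.1 : ℝ))).exists
  rw [evalForm_add_smul] at h2
  have h3 : 0 < (g.1 : ℝ) * g.1 + g.2.1 * g.2.1 := by
    rcases hg with h | h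
    · have : (g.1 : ℝ) ≠ 0 := by exact_mod_cast h
      nlinarith [mul_self_pos.2 this, mul_self_nonneg (g.2.1 : ℝ)]
    · have : (g.2.1 : ℝ) ≠ 0 := by exact_mod_cast h
      nlinarith [mul_self_pos.2 this, mul_self_nonneg (g.1 : ℝ)]
  have h4 := mul_pos ht h3
  simp only at h2
  nlinarith

lemma interior_F1_subset {s : ℝ} (hs : 0 < s) : interior (F1 s) ⊆ openF1 s := by
  intro p hp
  have h := mem_openF1_iff_forms 0 s p
  rw [zvec_zero, add_zero] at h
  refine h.2 fun g hg => evalForm_pos_of_eventually_nonneg (formsOne_ne_zero hg) ?_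
  filter_upwards [mem_interior_iff_mem_nhds.1 hp] with q hq
  rw [mem_F1_iff hs, abs_le, abs_le] at hq
  simp only [formsOne, List.mem_cons, List.not_mem_nil, or_false] at hg
  rcases hg with rfl | rfl | rfl | rfl <;> simp [evalForm] <;> linarith [hq.1.1, hq.1.2, hq.2.1, hq.2.2]

/-- The forms whose positivity characterises the four half-planes covering the complement
of `F₂`. -/
def sides : List (ℤ × ℤ × ℤ × ℤ) :=
  [(1, 0, 0, -1), (-1, 0, 0, -1), (1, 1, -1, 0), (-1, -1, -1, 0)]

lemma not_mem_F2_iff {s : ℝ} (hs : 0 < s) (p : ℝ × ℝ) :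
    p ∉ F2 s ↔ ∃ h ∈ sides, 0 < evalForm h s p := by
  rw [mem_F2_iff hs, not_and_or, not_le, not_le, lt_abs, lt_abs]
  simp only [sides, List.exists_mem_cons_iff, List.not_mem_nil, false_and, exists_false, or_false,
    or_assoc, evalForm]
  push_cast
  refine or_congr ?_ (or_congr ?_ (or_congr ?_ ?_)) <;> constructor <;> intro h <;> linarith

lemma sides_fst {h : ℤ × ℤ × ℤ × ℤ} (hh : h ∈ sides) : h.1 * h.1 = 1 := by
  simp only [sides, List.mem_cons, List.not_mem_nil, or_false] at hh
  rcases hh with rfl | rfl | rfl | rfl <;> simp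

/-- If `g > 0` on the part of a neighbourhood of `p` where `h > 0`, for an irrational parameter,
then the same holds near `p` for all nearby parameters. -/
lemma eventually_evalForm_pos {s : ℝ} (hs : Irrational s) {g h : ℤ × ℤ × ℤ × ℤ}
    (hh : h.1 * h.1 = 1) {p : ℝ × ℝ}
    (hg : ∀ᶠ q in 𝓝 p, 0 < evalForm h s q → 0 < evalForm g s q) :
    ∀ᶠ z in 𝓝 (s, p), 0 < evalForm h z.1 z.2 → 0 < evalForm g z.1 z.2 := by
  have cg := (continuous_evalForm g).continuousAt (x := (s, p))
  have ch := (continuous_evalForm h).continuousAt (x := (s, p))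
  rcases lt_trichotomy (evalForm h s p) 0 with h0 | h0 | h0
  · filter_upwards [ch.eventually_lt_const h0] with z hz hz2
    exact absurd hz2 hz.le.not_gt
  · by_cases hgp : 0 < evalForm g s p
    · filter_upwards [cg.eventually_const_lt hgp] with z hz _
      exact hz
    have hd : ∀ d : ℝ × ℝ, 0 < h.1 * d.1 + h.2.1 * d.2 →
        ∃ t : ℝ, 0 < t ∧ 0 < evalForm g s p + t * (g.1 * d.1 + g.2.1 * d.2) := by
      intro d hd
      obtain ⟨t, ht, h2⟩ := (exists_pos_of_eventually hg d).exists
      rw [evalForm_add_smul, evalForm_add_smul, h0, zero_add] at h2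
      exact ⟨t, ht, h2 (mul_pos ht hd)⟩
    have hd2 : ∀ d : ℝ × ℝ, 0 < h.1 * d.1 + h.2.1 * d.2 → 0 < (g.1 : ℝ) * d.1 + g.2.1 * d.2 := by
      intro d h1
      obtain ⟨t, ht, h2⟩ := hd d h1
      by_contra hc
      nlinarith
    have hg0 : evalForm g s p = 0 := by
      refine le_antisymm (not_lt.1 hgp) ?_
      have hhr : (h.1 : ℝ) * h.1 = 1 := by exact_mod_cast hh
      have h2 : Tendsto (fun t : ℝ => evalForm g s (p + t • ((h.1 : ℝ), (0 : ℝ)))) (𝓝[>] 0)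
          (𝓝 (evalForm g s p)) := by
        have hc : Continuous fun t : ℝ => evalForm g s (p + t • ((h.1 : ℝ), (0 : ℝ))) :=
          (continuous_evalForm_right g s).comp (by fun_prop)
        have := hc.tendsto 0
        rw [zero_smul, add_zero] at this
        exact this.mono_left nhdsWithin_le_nhds
      refine ge_of_tendsto h2 ?_
      filter_upwards [exists_pos_of_eventually hg ((h.1 : ℝ), (0 : ℝ))] with t ht
      refine (ht.2 ?_).le
      rw [evalForm_add_smul, h0]
      simp only [hhr, mul_zero]
      linarith [ht.1]
    have hperp : (g.1 : ℝ) * h.2.1 = g.2.1 * h.1 := by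
      have hpos : ∀ k : ℝ, 0 < (g.1 : ℝ) * h.1 + g.2.1 * h.2.1 + k * (g.2.1 * h.1 - g.1 * h.2.1) := by
        intro k
        have h1 : (h.1 : ℝ) * h.1 = 1 := by exact_mod_cast hh
        have := hd2 (h.1 - k * h.2.1, h.2.1 + k * h.1) (by
          simp only; nlinarith [mul_self_nonneg (h.2.1 : ℝ)])
        simp only at this
        linarith
      by_contra hc
      have hne : (g.2.1 : ℝ) * h.1 - g.1 * h.2.1 ≠ 0 := fun h => hc (by linarith)
      have h5 := hpos (-((g.1 : ℝ) * h.1 + g.2.1 * h.2.1) / (g.2.1 * h.1 - g.1 * h.2.1))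
      rw [div_mul_cancel₀ _ hne] at h5
      linarith
    have hperpZ : g.1 * h.2.1 = g.2.1 * h.1 := by exact_mod_cast hperp
    obtain ⟨l, hl⟩ : ∃ l : ℤ, l = g.1 * h.1 := ⟨_, rfl⟩
    have e1 : g.1 = l * h.1 := by rw [hl, mul_assoc, hh, mul_one]
    have e2 : g.2.1 = l * h.2.1 := by
      rw [hl, mul_right_comm, hperpZ, mul_assoc, hh, mul_one]
    have hlpos : (0 : ℝ) < l := by
      have := hd2 (h.1, 0) (by
        have h1 : (h.1 : ℝ) * h.1 = 1 := by exact_mod_cast hh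
        simp [h1])
      rw [hl]
      push_cast
      simpa using this
    have e34 : zvec (g.2.2.1 - l * h.2.2.1, g.2.2.2 - l * h.2.2.2, 0, 0) s = 0 := by
      simp only [zvec, Prod.mk_eq_zero]
      push_cast
      refine ⟨?_, by ring⟩
      have e1' : (g.1 : ℝ) = l * h.1 := by exact_mod_cast e1
      have e2' : (g.2.1 : ℝ) = l * h.2.1 := by exact_mod_cast e2
      unfold evalForm at hg0 h0
      rw [e1', e2'] at hg0
      linear_combination hg0 - l * h0
    have e5 := zvec_eq_zero hs e34
    simp only [Prod.mk_eq_zero] at e5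
    have e : ∀ s p, evalForm g s p = l * evalForm h s p := by
      intro s p
      have e3 : g.2.2.1 = l * h.2.2.1 := by linarith [e5.1]
      have e4 : g.2.2.2 = l * h.2.2.2 := by linarith [e5.2.1]
      simp only [evalForm, e1, e2, e3, e4]
      push_cast
      ring
    refine Eventually.of_forall fun z hz => ?_
    rw [e]
    exact mul_pos hlpos hz
  · filter_upwards [cg.eventually_const_lt (hg.self_of_nhds h0)] with z hz _
    exact hz

/-! ### Stability of periodic regions at irrational parameters -/

lemma mem_openF1_iff_forms_zero (s : ℝ) (p : ℝ × ℝ) :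
    p ∈ openF1 s ↔ ∀ g ∈ formsOne 0, 0 < evalForm g s p := by
  simpa only [zvec_zero, add_zero] using mem_openF1_iff_forms 0 s p

lemma eventually_mem_openF1 {s : ℝ} {p : ℝ × ℝ} (hp : p ∈ openF1 s) :
    ∀ᶠ z in 𝓝 (s, p), z.2 ∈ openF1 z.1 := by
  simp only [mem_openF1_iff_forms_zero] at hp ⊢
  refine (List.finite_toSet (formsOne 0)).eventually_all.2 fun g hg => ?_
  exact (continuous_evalForm g).continuousAt.eventually (lt_mem_nhds (hp g hg))

lemma evalForm_combo (g : ℤ × ℤ × ℤ × ℤ) (s : ℝ) (x y : ℝ × ℝ) {a b : ℝ} (hab : a + b = 1) :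
    evalForm g s (a • x + b • y) = a * evalForm g s x + b * evalForm g s y := by
  simp only [evalForm, Prod.fst_add, Prod.snd_add, Prod.smul_fst, Prod.smul_snd, smul_eq_mul]
  linear_combination -(g.2.2.1 + g.2.2.2 * s) * hab

lemma convex_evalForm_pos (g : ℤ × ℤ × ℤ × ℤ) (s : ℝ) : Convex ℝ {q | 0 < evalForm g s q} := by
  intro x hx y hy a b ha hb hab
  rw [mem_ofPred_eq] at hx hy ⊢
  rw [evalForm_combo g s x y hab]
  rcases ha.eq_or_lt with rfl | ha
  · rw [show b = 1 by linarith]; simpa using hy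
  · exact add_pos_of_pos_of_nonneg (mul_pos ha hx) (mul_nonneg hb hy.le)

lemma exists_side_code {s : ℝ} (hs : 0 < s) {O : Set (ℝ × ℝ)} (hO : Convex ℝ O)
    (hOF : O ⊆ openF1 s) {N : ℕ} (hN : 0 < N) (h : ∀ p ∈ O, IterRel s N p p)
    {g : ℤ × ℤ × ℤ × ℤ} (hg : g ∈ sides) (hne : (O ∩ {q | 0 < evalForm g s q}).Nonempty) :
    ∃ α, (∀ p ∈ O ∩ {q | 0 < evalForm g s q}, Follows s α p) ∧ zvec (disp α N) s = 0 := by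
  have key : ∀ p ∈ O ∩ {q | 0 < evalForm g s q}, ∃ α, Follows s α p ∧ zvec (disp α N) s = 0 :=
    fun p hp => exists_follows hs (hOF hp.1) ((not_mem_F2_iff hs p).2 ⟨g, hg, hp.2⟩) hN (h p hp.1)
  obtain ⟨α, hα⟩ := exists_common_code hs (hO.inter (convex_evalForm_pos g s)).isPreconnected
    fun p hp => (key p hp).imp fun α hα => hα.1
  obtain ⟨p, hp⟩ := hne
  obtain ⟨β, hβ, hβ0⟩ := key p hp
  exact ⟨α, hα, (hα p hp).unique hs hβ ▸ hβ0⟩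

lemma iterRel_eventually {s : ℝ} (hs0 : 0 < s) (hs : Irrational s) {O : Set (ℝ × ℝ)}
    (hOo : IsOpen O) (hO : Convex ℝ O)
    (hOF : O ⊆ openF1 s) {N : ℕ} (hN : 0 < N) (h : ∀ p ∈ O, IterRel s N p p) {p : ℝ × ℝ}
    (hp : p ∈ O) : ∀ᶠ z in 𝓝 (s, p), z.2 ∈ openF1 z.1 ∧ IterRel z.1 N z.2 z.2 := by
  have hpos : ∀ᶠ z : ℝ × (ℝ × ℝ) in 𝓝 (s, p), 0 < z.1 :=
    continuous_fst.continuousAt.eventually (lt_mem_nhds hs0)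
  have hside : ∀ g ∈ sides, ∃ α, disp α N = 0 ∧
      ∀ q ∈ O, 0 < evalForm g s q → Follows s α q := by
    intro g hg
    by_cases hne : (O ∩ {q | 0 < evalForm g s q}).Nonempty
    · obtain ⟨α, h1, h2⟩ := exists_side_code hs0 hO hOF hN h hg hne
      exact ⟨α, zvec_eq_zero hs h2, fun q hq hq' => h1 q ⟨hq, hq'⟩⟩
    · exact ⟨0, by simp [disp]; rfl, fun q hq hq' => absurd ⟨q, hq, hq'⟩ hne⟩
  choose! α hα0 hα using hside
  have hsteps : ∀ᶠ z in 𝓝 (s, p), ∀ g ∈ sides, ∀ t ∈ Iio N, ∀ f ∈ stepForms (α g t) (disp (α g) t),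
      0 < evalForm g z.1 z.2 → 0 < evalForm f z.1 z.2 := by
    refine (List.finite_toSet sides).eventually_all.2 fun g hg => ?_
    refine (finite_Iio N).eventually_all.2 fun t _ => ?_
    refine (List.finite_toSet _).eventually_all.2 fun f hf => ?_
    refine eventually_evalForm_pos hs (sides_fst hg) ?_
    filter_upwards [hOo.mem_nhds hp] with q hq hq'
    exact (strictStep_iff_forms _ _ _ _).1 (hα g hg q hq hq' t) f hf
  filter_upwards [hpos, eventually_mem_openF1 (hOF hp), hsteps] with z hz1 hz2 hz3
  refine ⟨hz2, ?_⟩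
  by_cases hF : z.2 ∈ F2 z.1
  · exact iterRel_self_of_mem hz1 hz2 hF N
  · obtain ⟨g, hg, hgz⟩ := (not_mem_F2_iff hz1 _).1 hF
    have := (iterRel_of_strictStep hz1 (α := α g) (openF1_subset hz1 hz2) N fun t ht =>
      (strictStep_iff_forms _ _ _ _).2 fun f hf => hz3 g hg t ht f hf hgz).1
    rwa [hα0 g hg, zvec_zero, add_zero] at this

lemma eventually_iterRel_of_isCompact {s : ℝ} (hs0 : 0 < s) (hs : Irrational s)
    {O K : Set (ℝ × ℝ)} (hOo : IsOpen O) (hO : Convex ℝ O)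
    (hOF : O ⊆ openF1 s) {N : ℕ} (hN : 0 < N) (h : ∀ p ∈ O, IterRel s N p p)
    (hK : IsCompact K) (hKO : K ⊆ O) :
    ∀ᶠ σ in 𝓝 s, ∀ p ∈ K, p ∈ openF1 σ ∧ IterRel σ N p p :=
  hK.eventually_forall_of_forall_eventually fun _ hp =>
    iterRel_eventually hs0 hs hOo hO hOF hN h (hKO hp)

/-! ### Limits of periodic regions -/

lemma IterRel.trans {s : ℝ} {m : ℕ} {p q r : ℝ × ℝ} (h : IterRel s m p q) :
    ∀ {n : ℕ}, IterRel s n q r → IterRel s (m + n) p r := by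
  intro n
  induction n generalizing r with
  | zero => rintro rfl; exact h
  | succ n ih => rintro ⟨x, h1, h2⟩; exact ⟨x, ih h1, h2⟩

lemma IterRel.mul {s : ℝ} {m : ℕ} {p : ℝ × ℝ} (h : IterRel s m p p) (n : ℕ) :
    IterRel s (m * n) p p := by
  induction n with
  | zero => exact rfl
  | succ n ih => exact ih.trans h

lemma IterRel.of_dvd {s : ℝ} {m n : ℕ} {p : ℝ × ℝ} (h : IterRel s m p p) (hmn : m ∣ n) :
    IterRel s n p p := by
  obtain ⟨c, rfl⟩ := hmn
  exact h.mul c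

lemma disp_congr {α β : ℕ → Letter} {n : ℕ} (h : ∀ t < n, α t = β t) : disp α n = disp β n :=
  Finset.sum_congr rfl fun t ht => by rw [h t (Finset.mem_range.1 ht)]

lemma exists_finite_words {L : Set Letter} (hL : L.Finite) (C : ℕ) :
    ∃ W : Set (ℕ → Letter), W.Finite ∧
      ∀ α : ℕ → Letter, (∀ t < C, α t ∈ L) → ∃ w ∈ W, ∀ t < C, w t = α t := by
  refine ⟨(fun (w : Fin C → Letter) t => if h : t < C then w ⟨t, h⟩ else 0) ''
    Set.pi univ fun _ => L, (Set.Finite.pi fun _ => hL).image _, fun α hα => ?_⟩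
  exact ⟨_, ⟨fun i => α i, fun i _ => hα i i.2, rfl⟩, fun t ht => by simp [ht]⟩

/-- A word of length `k` whose letters are realised from `p` on and whose total displacement
vanishes. -/
def ClosedWord (s : ℝ) (w : ℕ → Letter) (k : ℕ) (p : ℝ × ℝ) : Prop :=
  zvec (disp w k) s = 0 ∧ ∀ t < k, StrictStep s (w t) (p + zvec (disp w t) s)

lemma ClosedWord.iterRel {s : ℝ} (hs : 0 < s) {w : ℕ → Letter} {k : ℕ} {p : ℝ × ℝ}
    (h : ClosedWord s w k p) (hp : p ∈ openF1 s) : IterRel s k p p := by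
  have := (iterRel_of_strictStep hs (openF1_subset hs hp) k h.2).1
  rwa [h.1, add_zero] at this

lemma ClosedWord.congr {s : ℝ} {w α : ℕ → Letter} {k : ℕ} {p : ℝ × ℝ}
    (h : ClosedWord s α k p) (hw : ∀ t < k, w t = α t) : ClosedWord s w k p := by
  refine ⟨disp_congr hw ▸ h.1, fun t ht => ?_⟩
  rw [hw t ht, disp_congr fun t' ht' => hw t' (ht'.trans ht)]
  exact h.2 t ht

lemma exists_ball_subset_side {s : ℝ} {σ : ℕ → ℝ} (hlim : Tendsto σ atTop (𝓝 s))
    {U : ℕ → Set (ℝ × ℝ)} {q : ℝ × ℝ} (hq : ∃ ρ > 0, ∀ᶠ m in atTop, Metric.ball q ρ ⊆ U m)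
    {g : ℤ × ℤ × ℤ × ℤ} (hg : 0 < evalForm g s q) :
    ∃ ρ > 0, ∀ᶠ m in atTop, Metric.ball q ρ ⊆ U m ∩ {p | 0 < evalForm g (σ m) p} := by
  obtain ⟨ρ, hρ, h1⟩ := hq
  have h2 : ∀ᶠ z in 𝓝 (s, q), 0 < evalForm g z.1 z.2 :=
    (continuous_evalForm g).continuousAt.eventually (lt_mem_nhds hg)
  rw [nhds_prod_eq, eventually_prod_iff] at h2
  obtain ⟨pa, ha, pb, hb, hab⟩ := h2
  obtain ⟨δ, hδ, hδb⟩ := Metric.eventually_nhds_iff_ball.1 hb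
  refine ⟨min ρ δ, lt_min hρ hδ, ?_⟩
  filter_upwards [h1, hlim.eventually ha] with m hm hm' p hp
  exact ⟨hm (Metric.ball_subset_ball (min_le_left _ _) hp),
    hab hm' (hδb p (Metric.ball_subset_ball (min_le_right _ _) hp))⟩

lemma exists_closedWord_of_ball {s : ℝ} (hs : s ∈ Ioo (0 : ℝ) 1) {U : Set (ℝ × ℝ)}
    (hUc : Convex ℝ U) (hUF : U ⊆ openF1 s) {N : ℕ} (hN : 0 < N)
    (hper : ∀ p ∈ U, IterRel s N p p) {g : ℤ × ℤ × ℤ × ℤ} (hg : g ∈ sides) {q : ℝ × ℝ} {ρ : ℝ}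
    (hρ : 0 < ρ) (hball : Metric.ball q ρ ⊆ U ∩ {p | 0 < evalForm g s p}) {C : ℕ}
    (hC : ∀ x : ℕ → ℝ × ℝ, (∀ t, ‖x t‖ ≤ 2) → ∃ i j, i < j ∧ j ≤ C ∧ dist (x j) (x i) < ρ) :
    ∃ k ∈ Icc 1 C, ∃ α : ℕ → Letter, ∀ p ∈ U ∩ {p | 0 < evalForm g s p},
      Follows s α p ∧ ClosedWord s α k p := by
  have hq := hball (Metric.mem_ball_self hρ)
  obtain ⟨α, hα, hα0⟩ := exists_side_code hs.1 hUc hUF hN hper hg ⟨q, hq⟩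
  obtain ⟨i, j, hij, hjC, hd⟩ := hC (fun t => q + zvec (disp α t) s) fun t =>
    norm_le_of_mem_openF1 hs.2 ((hα q hq).mem_openF1 (hUF hq.1) t)
  have h0 := exists_small_period hs.1 hq hα hN hα0 hij (hball (by
    rw [Metric.mem_ball, dist_eq_norm]
    rw [dist_eq_norm] at hd
    convert hd using 2
    abel))
  exact ⟨j - i, ⟨by omega, by omega⟩, α, fun p hp => ⟨hα p hp, h0, fun t _ => hα p hp t⟩⟩

lemma exists_side_period_of_limit {s : ℝ} (hs : s ∈ Ioo (0 : ℝ) 1) {σ : ℕ → ℝ}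
    (hσ : ∀ m, σ m ∈ Ioo (0 : ℝ) 1) (hlim : Tendsto σ atTop (𝓝 s)) {U : ℕ → Set (ℝ × ℝ)}
    (hUc : ∀ m, Convex ℝ (U m)) (hUF : ∀ m, U m ⊆ openF1 (σ m))
    (hper : ∀ m, ∃ n, 0 < n ∧ ∀ p ∈ U m, IterRel (σ m) n p p) {O : Set (ℝ × ℝ)}
    (hOF : O ⊆ openF1 s)
    (hball : ∀ q ∈ O, ∃ ρ > 0, ∀ᶠ m in atTop, Metric.ball q ρ ⊆ U m)
    {g : ℤ × ℤ × ℤ × ℤ} (hg : g ∈ sides) :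
    ∃ k, 0 < k ∧ ∀ q ∈ O, 0 < evalForm g s q → IterRel s k q q := by
  by_cases hne : ∃ q ∈ O, 0 < evalForm g s q
  swap
  · exact ⟨1, one_pos, fun q hq hq' => absurd ⟨q, hq, hq'⟩ hne⟩
  obtain ⟨q₀, hq₀, hg₀⟩ := hne
  obtain ⟨ρ, hρ, hρ'⟩ := exists_ball_subset_side hlim (hball q₀ hq₀) hg₀
  obtain ⟨C, hC⟩ := exists_pigeonhole_bound hρ
  obtain ⟨L, hL, hL'⟩ := exists_finite_letters (half_pos hs.1)
  obtain ⟨W, hW, hW'⟩ := exists_finite_words hL C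
  have h1 : ∀ᶠ m in atTop, ∃ k ∈ Icc 1 C, ∃ w ∈ W,
      ∀ p ∈ U m ∩ {p | 0 < evalForm g (σ m) p}, ClosedWord (σ m) w k p := by
    filter_upwards [hρ', hlim.eventually (lt_mem_nhds (half_lt_self hs.1))] with m hm hm'
    obtain ⟨N, hN, hper⟩ := hper m
    obtain ⟨k, hk, α, hα⟩ := exists_closedWord_of_ball (hσ m) (hUc m) (hUF m) hN hper hg hρ hm hC
    have hq := hm (Metric.mem_ball_self hρ)
    obtain ⟨w, hw, hwα⟩ := hW' α fun t _ => hL' (σ m) _ _ hm'.le (hσ m).2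
      ((hα q₀ hq).1.mem_openF1 (hUF m hq.1) t) ((hα q₀ hq).1 t)
    exact ⟨k, hk, w, hw, fun p hp => (hα p hp).2.congr fun t ht => hwα t (ht.trans_le hk.2)⟩
  obtain ⟨k, hk, w, -, hkw⟩ : ∃ k ∈ Icc 1 C, ∃ w ∈ W, ∃ᶠ m in atTop,
      ∀ p ∈ U m ∩ {p | 0 < evalForm g (σ m) p}, ClosedWord (σ m) w k p := by
    by_contra! hcon
    have h2 := (finite_Icc 1 C).eventually_all.2 fun k hk =>
      hW.eventually_all.2 fun w hw => hcon k hk w hw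
    obtain ⟨m, ⟨k, hk, w, hw, h⟩, h'⟩ := (h1.and h2).exists
    obtain ⟨p, hp, hp'⟩ := h' k hk w hw
    exact hp' (h p hp)
  refine ⟨k, hk.1, fun q hq hq' => ClosedWord.iterRel hs.1 (w := w) ⟨?_, fun t ht => ?_⟩ (hOF hq)⟩
  · have hc : Continuous (zvec (disp w k)) := by unfold zvec; fun_prop
    refine tendsto_nhds_unique_of_frequently_eq ((hc.tendsto s).comp hlim)
      (tendsto_const_nhds (x := (0 : ℝ × ℝ))) ?_
    refine (hkw.and_eventually hρ').mono ?_
    rintro m ⟨h1, h2⟩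
    exact (h1 q₀ (h2 (Metric.mem_ball_self hρ))).1
  · obtain ⟨δ, hδ, hδ'⟩ := exists_ball_subset_side hlim (hball q hq) hq'
    refine (strictStep_iff_forms _ _ _ _).2 fun f hf =>
      evalForm_pos_of_eventually_nonneg (stepForms_ne_zero hf) ?_
    filter_upwards [Metric.ball_mem_nhds q hδ] with p hp
    have hc : Tendsto (fun m => evalForm f (σ m) p) atTop (𝓝 (evalForm f s p)) :=
      (((continuous_evalForm f).comp (Continuous.prodMk_left p)).tendsto s).comp hlim
    refine ge_of_tendsto_of_frequently hc ((hkw.and_eventually hδ').mono ?_)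
    rintro m ⟨h1, h2⟩
    exact ((strictStep_iff_forms _ _ _ _).1 ((h1 p (h2 hp)).2 t ht) f hf).le

lemma exists_period_of_limit {s : ℝ} (hs : s ∈ Ioo (0 : ℝ) 1) {σ : ℕ → ℝ}
    (hσ : ∀ m, σ m ∈ Ioo (0 : ℝ) 1) (hlim : Tendsto σ atTop (𝓝 s)) {U : ℕ → Set (ℝ × ℝ)}
    (hUc : ∀ m, Convex ℝ (U m)) (hUF : ∀ m, U m ⊆ openF1 (σ m))
    (hper : ∀ m, ∃ n, 0 < n ∧ ∀ p ∈ U m, IterRel (σ m) n p p) {O : Set (ℝ × ℝ)}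
    (hOF : O ⊆ openF1 s)
    (hball : ∀ q ∈ O, ∃ ρ > 0, ∀ᶠ m in atTop, Metric.ball q ρ ⊆ U m) :
    ∃ n, 0 < n ∧ ∀ q ∈ O, IterRel s n q q := by
  have h : ∀ g ∈ sides, ∃ k, 0 < k ∧ ∀ q ∈ O, 0 < evalForm g s q → IterRel s k q q :=
    fun g hg => exists_side_period_of_limit hs hσ hlim hUc hUF hper hOF hball hg
  choose! k hk0 hk using h
  refine ⟨(sides.map k).prod, List.prod_pos ?_, fun q hq => ?_⟩
  · simpa only [List.forall_mem_map] using hk0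
  · by_cases hF : q ∈ F2 s
    · exact iterRel_self_of_mem hs.1 (hOF hq) hF _
    · obtain ⟨g, hg, hgq⟩ := (not_mem_F2_iff hs.1 _).1 hF
      exact (hk g hg q hq hgq).of_dvd (List.dvd_prod (List.mem_map_of_mem hg))

/-! ### Polygons and finite unions of convex sets -/

lemma IsConvexPolygon.convex {P : Set (ℝ × ℝ)} (h : IsConvexPolygon P) : Convex ℝ P := by
  obtain ⟨⟨V, rfl⟩, -⟩ := h
  exact convex_convexHull ℝ _

lemma IsConvexPolygon.isCompact {P : Set (ℝ × ℝ)} (h : IsConvexPolygon P) : IsCompact P := by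
  obtain ⟨⟨V, rfl⟩, -⟩ := h
  exact V.finite_toSet.isCompact_convexHull ℝ

lemma IsConvexPolygon.closure_interior {P : Set (ℝ × ℝ)} (h : IsConvexPolygon P) :
    closure (interior P) = P := by
  rw [h.convex.closure_interior_eq_closure_of_nonempty_interior h.2, h.isCompact.isClosed.closure_eq]

/-- The intersection of the closed half-planes `f ≤ u` with `(f, u) ∈ J`. -/
def halfPlanes (J : Set (StrongDual ℝ (ℝ × ℝ) × ℝ)) : Set (ℝ × ℝ) := {x | ∀ j ∈ J, j.1 x ≤ j.2}

lemma convex_halfPlanes (J : Set (StrongDual ℝ (ℝ × ℝ) × ℝ)) : Convex ℝ (halfPlanes J) := by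
  intro x hx y hy a b ha hb hab j hj
  rw [map_add, map_smul, map_smul, smul_eq_mul, smul_eq_mul]
  calc a * j.1 x + b * j.1 y ≤ a * j.2 + b * j.2 := by
        gcongr
        exacts [hx j hj, hy j hj]
    _ = j.2 := by rw [← add_mul, hab, one_mul]

lemma isClosed_halfPlanes (J : Set (StrongDual ℝ (ℝ × ℝ) × ℝ)) : IsClosed (halfPlanes J) := by
  have : halfPlanes J = ⋂ j ∈ J, {x | j.1 x ≤ j.2} := by ext; simp [halfPlanes]
  rw [this]
  exact isClosed_biInter fun j _ => isClosed_le (by fun_prop) (by fun_prop)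

lemma finite_extremePoints_halfPlanes {J : Set (StrongDual ℝ (ℝ × ℝ) × ℝ)} (hJ : J.Finite) :
    (extremePoints ℝ (halfPlanes J)).Finite := by
  refine Set.Finite.of_injOn (f := fun x => {j ∈ J | j.1 x = j.2}) (t := 𝒫 J)
    (fun x _ => sep_subset _ _) ?_ hJ.finite_subsets
  intro x hx y hy hxy
  have h1 : ∀ᶠ t : ℝ in 𝓝[>] 0, 0 < t ∧ ∀ j ∈ J, j.1 (x + t • (x - y)) ≤ j.2 := by
    refine Filter.Eventually.and self_mem_nhdsWithin (hJ.eventually_all.2 fun j hj => ?_)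
    by_cases hxj : j.1 x = j.2
    · have hyj : j ∈ {j ∈ J | j.1 y = j.2} := hxy.subset ⟨hj, hxj⟩
      filter_upwards with t
      simp [hxj, hyj.2]
    · have hc : Continuous fun t : ℝ => j.1 (x + t • (x - y)) := by fun_prop
      have h2 := hc.tendsto 0
      rw [zero_smul, add_zero] at h2
      exact nhdsWithin_le_nhds ((h2.eventually (gt_mem_nhds ((hx.1 j hj).lt_of_ne hxj))).mono
        fun t => le_of_lt)
  obtain ⟨t, ht, hxt⟩ := h1.exists
  refine ((mem_extremePoints.1 hx).2 _ hxt y hy.1 ?_).2.symm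
  refine ⟨1 / (1 + t), t / (1 + t), by positivity, by positivity, by field_simp, ?_⟩
  ext <;> simp <;> field_simp <;> ring

lemma isConvexPolygon_halfPlanes {J : Set (StrongDual ℝ (ℝ × ℝ) × ℝ)} (hJ : J.Finite)
    (hb : Bornology.IsBounded (halfPlanes J)) (hi : (interior (halfPlanes J)).Nonempty) :
    IsConvexPolygon (halfPlanes J) := by
  have hfin := finite_extremePoints_halfPlanes hJ
  refine ⟨⟨hfin.toFinset, ?_⟩, hi⟩
  have hc : IsCompact (halfPlanes J) := Metric.isCompact_of_isClosed_isBounded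
    (isClosed_halfPlanes J) hb
  rw [hfin.coe_toFinset, ← (hfin.isCompact_convexHull ℝ).isClosed.closure_eq,
    closure_convexHull_extremePoints hc (convex_halfPlanes J)]

/-- A finite union of convex sets. -/
def IsConvexUnion (B : Set (ℝ × ℝ)) : Prop :=
  ∃ 𝒞 : Set (Set (ℝ × ℝ)), 𝒞.Finite ∧ (∀ C ∈ 𝒞, Convex ℝ C) ∧ B = ⋃₀ 𝒞

lemma Convex.isConvexUnion {B : Set (ℝ × ℝ)} (h : Convex ℝ B) : IsConvexUnion B :=
  ⟨{B}, finite_singleton B, by simpa using h, by simp⟩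

lemma IsConvexUnion.inter {A B : Set (ℝ × ℝ)} (hA : IsConvexUnion A) (hB : IsConvexUnion B) :
    IsConvexUnion (A ∩ B) := by
  obtain ⟨𝒞, h1, h2, rfl⟩ := hA
  obtain ⟨𝒟, h3, h4, rfl⟩ := hB
  refine ⟨image2 (· ∩ ·) 𝒞 𝒟, h1.image2 _ h3, ?_, ?_⟩
  · rintro _ ⟨C, hC, D, hD, rfl⟩
    exact (h2 C hC).inter (h4 D hD)
  · ext x
    simp only [mem_inter_iff, mem_sUnion, mem_image2]
    constructor
    · rintro ⟨⟨C, hC, hx⟩, D, hD, hx'⟩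
      exact ⟨_, ⟨C, hC, D, hD, rfl⟩, hx, hx'⟩
    · rintro ⟨_, ⟨C, hC, D, hD, rfl⟩, hx, hx'⟩
      exact ⟨⟨C, hC, hx⟩, D, hD, hx'⟩

lemma IsConvexUnion.union {A B : Set (ℝ × ℝ)} (hA : IsConvexUnion A) (hB : IsConvexUnion B) :
    IsConvexUnion (A ∪ B) := by
  obtain ⟨𝒞, h1, h2, rfl⟩ := hA
  obtain ⟨𝒟, h3, h4, rfl⟩ := hB
  exact ⟨𝒞 ∪ 𝒟, h1.union h3, fun C hC => hC.elim (h2 C) (h4 C), (sUnion_union _ _).symm⟩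

lemma isConvexUnion_setOf_exists {ι : Type*} {I : Set ι} (hI : I.Finite) {Q : ι → ℝ × ℝ → Prop}
    (h : ∀ i ∈ I, IsConvexUnion {p | Q i p}) : IsConvexUnion {p | ∃ i ∈ I, Q i p} := by
  induction I, hI using Set.Finite.induction_on with
  | empty => simpa using (convex_empty (𝕜 := ℝ) (E := ℝ × ℝ)).isConvexUnion
  | insert ha hs ih =>
    have := (h _ (mem_insert _ _)).union (ih fun i hi => h i (mem_insert_of_mem _ hi))
    convert this using 1
    ext p
    simp [or_and_right, exists_or]

lemma isConvexUnion_setOf_forall {ι : Type*} {I : Set ι} (hI : I.Finite) {Q : ι → ℝ × ℝ → Prop}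
    (h : ∀ i ∈ I, IsConvexUnion {p | Q i p}) : IsConvexUnion {p | ∀ i ∈ I, Q i p} := by
  induction I, hI using Set.Finite.induction_on with
  | empty => simpa using (convex_univ (𝕜 := ℝ) (E := ℝ × ℝ)).isConvexUnion
  | insert ha hs ih =>
    have := (h _ (mem_insert _ _)).inter (ih fun i hi => h i (mem_insert_of_mem _ hi))
    convert this using 1
    ext p
    simp

lemma exists_maximal_polygon {J : Set (StrongDual ℝ (ℝ × ℝ) × ℝ)} (hJ : J.Finite)
    (hb : Bornology.IsBounded (halfPlanes J)) {S : Set (ℝ × ℝ)} (hS : IsConvexUnion Sᶜ)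
    {U₀ : Set (ℝ × ℝ)} (hUo : IsOpen U₀) (hUc : Convex ℝ U₀) (hUne : U₀.Nonempty)
    (hUS : U₀ ⊆ S ∩ halfPlanes J) :
    ∃ P, IsConvexPolygon P ∧ P ⊆ halfPlanes J ∧ U₀ ⊆ P ∧ interior P ⊆ S ∧
      ∀ Q, IsConvexPolygon Q → Q ⊆ halfPlanes J → interior Q ⊆ S → P ⊆ Q → P = Q := by
  obtain ⟨U, hU₀U, hU⟩ := zorn_subset_nonempty
    {U | IsOpen U ∧ Convex ℝ U ∧ U ⊆ S ∩ halfPlanes J}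
    (fun c hc hchain _ => ⟨⋃₀ c, ⟨isOpen_sUnion fun A hA => (hc hA).1,
      DirectedOn.convex_sUnion hchain.directedOn fun A hA => (hc hA).2.1,
      sUnion_subset fun A hA => (hc hA).2.2⟩, fun A hA => subset_sUnion_of_mem hA⟩)
    U₀ ⟨hUo, hUc, hUS⟩
  obtain ⟨hU1, hU2, hU3⟩ := hU.prop
  have hUne := hUne.mono hU₀U
  obtain ⟨𝒞, hfin, hconv, hSc⟩ := hS
  have hsep : ∀ C ∈ 𝒞, ∃ j : StrongDual ℝ (ℝ × ℝ) × ℝ, (∀ a ∈ U, j.1 a < j.2) ∧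
      ∀ b ∈ C, j.2 ≤ j.1 b := by
    intro C hC
    obtain ⟨f, u, h⟩ := geometric_hahn_banach_open hU2 hU1 (hconv C hC)
      (disjoint_left.2 fun x hx hxC => by
        have : x ∈ Sᶜ := hSc ▸ mem_sUnion_of_mem hxC hC
        exact this (hU3 hx).1)
    exact ⟨(f, u), h⟩
  choose! j hjU hjC using hsep
  set P := halfPlanes (J ∪ j '' 𝒞) with hPdef
  have hPJ : P ⊆ halfPlanes J := fun x hx i hi => hx i (Or.inl hi)
  have hUP : U ⊆ P := by
    rintro x hx i (hi | ⟨C, hC, rfl⟩)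
    · exact (hU3 hx).2 i hi
    · exact (hjU C hC x hx).le
  have hUiP : U ⊆ interior P := interior_maximal hUP hU1
  have hPS : interior P ⊆ S := by
    intro p hp
    by_contra hpS
    have : p ∈ ⋃₀ 𝒞 := hSc ▸ hpS
    obtain ⟨C, hC, hpC⟩ := this
    obtain ⟨a, ha⟩ := hUne
    obtain ⟨t, ht, hpt⟩ := (exists_pos_of_eventually (mem_interior_iff_mem_nhds.1 hp)
      (p - a)).exists
    have h1 := hpt (j C) (Or.inr ⟨C, hC, rfl⟩)
    rw [map_add, map_smul, map_sub, smul_eq_mul] at h1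
    have h2 := hjC C hC p hpC
    have h3 := mul_pos ht (sub_pos.2 ((hjU C hC a ha).trans_le h2))
    linarith
  have hPpoly : IsConvexPolygon P := isConvexPolygon_halfPlanes (hJ.union (hfin.image _))
    (hb.subset hPJ) (hUne.mono hUiP)
  refine ⟨P, hPpoly, hPJ, hU₀U.trans hUP, hPS, fun Q hQ hQJ hQS hPQ => hPQ.antisymm ?_⟩
  have h4 : interior Q ⊆ U := hU.2 ⟨isOpen_interior, hQ.convex.interior,
    subset_inter hQS (interior_subset.trans hQJ)⟩ (hUiP.trans (interior_mono hPQ))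
  rw [← hQ.closure_interior]
  exact hPpoly.isCompact.isClosed.closure_subset_iff.2 (h4.trans hUP)

/-! ### Rational parameters: periodic polygons lie in periodic tiles -/

lemma exists_halfPlanes_eq_F1 {s : ℝ} (hs : 0 < s) :
    ∃ J : Set (StrongDual ℝ (ℝ × ℝ) × ℝ), J.Finite ∧ halfPlanes J = F1 s := by
  let x : StrongDual ℝ (ℝ × ℝ) := ContinuousLinearMap.fst ℝ ℝ ℝ
  let y : StrongDual ℝ (ℝ × ℝ) := ContinuousLinearMap.snd ℝ ℝ ℝ
  refine ⟨{(y, s), (-y, s), (x - y, 1), (y - x, 1)}, by simp, ?_⟩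
  ext p
  rw [mem_F1_iff hs, abs_le, abs_le, halfPlanes, mem_ofPred_eq]
  simp only [mem_insert_iff, mem_singleton_iff, forall_eq_or_imp, forall_eq]
  simp only [x, y, ContinuousLinearMap.coe_snd', neg_apply, sub_apply,
    ContinuousLinearMap.coe_fst']
  constructor
  · rintro ⟨h1, h2, h3, h4⟩
    exact ⟨⟨by linarith, h1⟩, by linarith, h3⟩
  · rintro ⟨⟨h1, h2⟩, h3, h4⟩
    exact ⟨h2, by linarith, h4, by linarith⟩

lemma F1_subset_closedBall {s : ℝ} (hs : s ∈ Ioo (0 : ℝ) 1) :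
    F1 s ⊆ Metric.closedBall (0 : ℝ × ℝ) 2 := by
  intro p hp
  obtain ⟨hs0, hs1⟩ := hs
  rw [mem_F1_iff hs0, abs_le, abs_le] at hp
  rw [mem_closedBall_zero_iff, Prod.norm_def, Real.norm_eq_abs, Real.norm_eq_abs, max_le_iff,
    abs_le, abs_le]
  refine ⟨⟨?_, ?_⟩, ?_, ?_⟩ <;> linarith [hp.1.1, hp.1.2, hp.2.1, hp.2.2]

lemma isConvexUnion_evalForm_nonpos (g : ℤ × ℤ × ℤ × ℤ) (s : ℝ) :
    IsConvexUnion {p | evalForm g s p ≤ 0} := by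
  refine Convex.isConvexUnion ?_
  intro x hx y hy a b ha hb hab
  rw [mem_ofPred_eq] at hx hy ⊢
  rw [evalForm_combo g s x y hab]
  exact add_nonpos (mul_nonpos_of_nonneg_of_nonpos ha hx) (mul_nonpos_of_nonneg_of_nonpos hb hy)

lemma isConvexUnion_not_forall_forms (l : List (ℤ × ℤ × ℤ × ℤ)) (s : ℝ) :
    IsConvexUnion {p | ¬ ∀ g ∈ l, 0 < evalForm g s p} := by
  simp only [not_forall, not_lt, exists_prop]
  exact isConvexUnion_setOf_exists (List.finite_toSet l) fun g _ => isConvexUnion_evalForm_nonpos g s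

lemma isConvexUnion_not_closedWord (s : ℝ) (w : ℕ → Letter) (k : ℕ) :
    IsConvexUnion {p | ¬ ClosedWord s w k p} := by
  by_cases h : zvec (disp w k) s = 0
  · simp only [ClosedWord, h, true_and, strictStep_iff_forms]
    have := isConvexUnion_setOf_exists (finite_Iio k) (fun t _ =>
      isConvexUnion_not_forall_forms (stepForms (w t) (disp w t)) s)
    convert this using 4
    simp
  · simpa [ClosedWord, h] using (convex_univ (𝕜 := ℝ) (E := ℝ × ℝ)).isConvexUnion

/-- Points that are fixed by `f_s` or follow one of the words in `W` of length at most `C`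
back to themselves. -/
def closedWordSet (s : ℝ) (C : ℕ) (W : Set (ℕ → Letter)) : Set (ℝ × ℝ) :=
  {p | p ∈ openF1 s ∧ (p ∈ F2 s ∨ ∃ k ∈ Icc 1 C, ∃ w ∈ W, ClosedWord s w k p)}

lemma isConvexUnion_compl_closedWordSet {s : ℝ} (hs : 0 < s) (C : ℕ) {W : Set (ℕ → Letter)}
    (hW : W.Finite) : IsConvexUnion (closedWordSet s C W)ᶜ := by
  have h1 : IsConvexUnion {p | p ∉ openF1 s} := by
    simp only [mem_openF1_iff_forms_zero]
    exact isConvexUnion_not_forall_forms _ _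
  have h2 : IsConvexUnion {p | p ∉ F2 s} := by
    simp only [not_mem_F2_iff hs]
    exact isConvexUnion_setOf_exists (List.finite_toSet sides) fun g _ =>
      (convex_evalForm_pos g s).isConvexUnion
  have h3 := isConvexUnion_setOf_forall (finite_Icc 1 C) (fun k _ =>
      isConvexUnion_setOf_forall hW fun w _ => isConvexUnion_not_closedWord s w k)
  convert h1.union (h2.inter h3) using 1
  ext p
  simp only [closedWordSet, mem_compl_iff, mem_ofPred_eq, mem_union, mem_inter_iff]
  push Not
  tauto

lemma iterRel_of_mem_closedWordSet {s : ℝ} (hs : 0 < s) {C : ℕ} {W : Set (ℕ → Letter)}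
    {p : ℝ × ℝ} (hp : p ∈ closedWordSet s C W) : IterRel s C.factorial p p := by
  obtain ⟨hp1, hp2 | ⟨k, hk, w, -, hw⟩⟩ := hp
  · exact iterRel_self_of_mem hs hp1 hp2 _
  · exact (hw.iterRel hs hp1).of_dvd (Nat.dvd_factorial hk.1 hk.2)

lemma eq_zero_of_abs_lt_inv_den (q : ℚ) (a c : ℤ) (h : |(a + c * q : ℝ)| < 1 / q.den) :
    (a + c * q : ℝ) = 0 := by
  have hd : (0 : ℝ) < q.den := by exact_mod_cast q.den_pos
  have hq : (q : ℝ) * q.den = q.num := by exact_mod_cast Rat.mul_den_eq_num q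
  have h1 : (a + c * q : ℝ) * q.den = ((a * q.den + c * q.num : ℤ) : ℝ) := by
    push_cast
    linear_combination (c : ℝ) * hq
  rw [lt_div_iff₀ hd, ← abs_of_pos hd, ← abs_mul, h1, ← Int.cast_abs] at h
  have h2 : |a * (q.den : ℤ) + c * q.num| < 1 := by exact_mod_cast h
  rw [Int.abs_lt_one_iff] at h2
  rw [h2, Int.cast_zero] at h1
  exact (mul_eq_zero.1 h1).resolve_right hd.ne'

lemma zvec_eq_zero_of_norm_lt (q : ℚ) (u : ℤ × ℤ × ℤ × ℤ) (h : ‖zvec u q‖ < 1 / q.den) :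
    zvec u q = 0 := by
  rw [Prod.norm_def, max_lt_iff] at h
  exact Prod.ext (eq_zero_of_abs_lt_inv_den q _ _ h.1) (eq_zero_of_abs_lt_inv_den q _ _ h.2)

lemma exists_closedWordSet (q : ℚ) (hq : (q : ℝ) ∈ Ioo (0 : ℝ) 1) :
    ∃ (C : ℕ) (W : Set (ℕ → Letter)), W.Finite ∧ ∀ p ∈ openF1 (q : ℝ), ∀ n, 0 < n →
      IterRel q n p p → p ∈ closedWordSet q C W := by
  have hd : (0 : ℝ) < 1 / q.den := by have := q.den_pos; positivity
  obtain ⟨C, hC⟩ := exists_pigeonhole_bound hd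
  obtain ⟨L, hL, hL'⟩ := exists_finite_letters hq.1
  obtain ⟨W, hW, hW'⟩ := exists_finite_words hL C
  refine ⟨C, W, hW, fun p hp n hn hpn => ⟨hp, or_iff_not_imp_left.2 fun hF => ?_⟩⟩
  obtain ⟨α, hα, hα0⟩ := exists_follows hq.1 hp hF hn hpn
  obtain ⟨i, j, hij, hjC, hdist⟩ := hC (fun t => p + zvec (disp α t) q) fun t =>
    norm_le_of_mem_openF1 hq.2 (hα.mem_openF1 hp t)
  rw [dist_add_left, dist_eq_norm, ← zvec_sub] at hdist
  have h0 := zvec_eq_zero_of_norm_lt q _ hdist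
  rw [zvec_sub] at h0
  have h1 := exists_small_period (A := {p}) hq.1 rfl (by rintro _ rfl; exact hα) hn hα0 hij
    (by rw [h0, add_zero]; rfl)
  obtain ⟨w, hw, hwα⟩ := hW' α fun t _ => hL' q _ _ le_rfl hq.2 (hα.mem_openF1 hp t) (hα t)
  exact ⟨j - i, ⟨by omega, by omega⟩, w, hw,
    ClosedWord.congr ⟨h1, fun t _ => hα t⟩ fun t ht => hwα t (by omega)⟩

lemma exists_tile_of_rational (q : ℚ) (hq : (q : ℝ) ∈ Ioo (0 : ℝ) 1) {Q : Set (ℝ × ℝ)}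
    (hQ : IsConvexPolygon Q) (hQF : Q ⊆ F1 q)
    (hper : ∃ n, 0 < n ∧ ∀ p ∈ interior Q, IterRel q n p p) :
    ∃ T, IsPeriodicTile q T ∧ Q ⊆ T := by
  obtain ⟨C, W, hW, hCW⟩ := exists_closedWordSet q hq
  obtain ⟨J, hJ, hJF⟩ := exists_halfPlanes_eq_F1 hq.1
  have hmem : ∀ R ⊆ F1 (q : ℝ), (∃ n, 0 < n ∧ ∀ p ∈ interior R, IterRel q n p p) →
      interior R ⊆ closedWordSet q C W := fun R hR ⟨n, hn, h⟩ p hp =>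
    hCW p (interior_F1_subset hq.1 (interior_mono hR hp)) n hn (h p hp)
  obtain ⟨T, hT, hTJ, hQT, hTS, hmax⟩ := exists_maximal_polygon hJ
    (hJF ▸ Metric.isBounded_closedBall.subset (F1_subset_closedBall hq))
    (isConvexUnion_compl_closedWordSet hq.1 C hW) isOpen_interior hQ.convex.interior hQ.2
    (subset_inter (hmem Q hQF hper) (hJF ▸ interior_subset.trans hQF))
  rw [hJF] at hTJ hmax
  refine ⟨T, ⟨hT, hTJ, ⟨C.factorial, C.factorial_pos, fun p hp =>
    iterRel_of_mem_closedWordSet hq.1 (hTS hp)⟩, fun R hR hRF hRper hTR =>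
    hmax R hR hRF (hmem R hRF hRper) hTR⟩, ?_⟩
  rw [← hQ.closure_interior]
  exact hT.isCompact.isClosed.closure_subset_iff.2 hQT

/-! ### Hausdorff approximation -/

lemma ball_half_subset_of_forall_near {T : Set (ℝ × ℝ)} (hT : Convex ℝ T) (hTc : IsClosed T)
    {q : ℝ × ℝ} {δ : ℝ} (hδ : 0 < δ)
    (h : ∀ u ∈ Metric.ball q δ, ∃ y ∈ T, dist y u ≤ δ / 4) : Metric.ball q (δ / 2) ⊆ T := by
  intro x hx
  by_contra hxT
  obtain ⟨f, u, hfx, hfT⟩ := geometric_hahn_banach_point_closed hT hTc hxT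
  have hf : f ≠ 0 := by
    rintro rfl
    obtain ⟨y, hy, -⟩ := h q (Metric.mem_ball_self hδ)
    have := hfx.trans (hfT y hy)
    simp at this
  have hf' := norm_pos_iff.2 hf
  obtain ⟨v, hv, hfv⟩ : ∃ v : ℝ × ℝ, ‖v‖ < 1 ∧ ‖f‖ / 2 < f v := by
    obtain ⟨v, hv, hfv⟩ := f.exists_lt_apply_of_lt_opNorm (half_lt_self hf')
    rcases lt_abs.1 hfv with h | h
    · exact ⟨v, hv, h⟩
    · exact ⟨-v, by rwa [norm_neg], by rwa [map_neg]⟩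
  have hw : x - (δ / 2) • v ∈ Metric.ball q δ := by
    rw [Metric.mem_ball, dist_eq_norm] at hx ⊢
    calc ‖x - (δ / 2) • v - q‖ = ‖(x - q) - (δ / 2) • v‖ := by congr 1; abel
      _ ≤ ‖x - q‖ + ‖(δ / 2) • v‖ := norm_sub_le _ _
      _ < δ / 2 + δ / 2 * 1 := by
        rw [norm_smul, Real.norm_of_nonneg (half_pos hδ).le]
        gcongr
      _ = δ := by ring
  obtain ⟨y, hy, hyw⟩ := h _ hw
  have h1 : f (y - (x - (δ / 2) • v)) ≤ ‖f‖ * (δ / 4) :=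
    (le_abs_self _).trans ((f.le_opNorm _).trans (by rw [← dist_eq_norm]; gcongr))
  rw [map_sub, map_sub, map_smul, smul_eq_mul] at h1
  have h2 := hfT y hy
  have h3 : δ / 2 * (‖f‖ / 2) < δ / 2 * f v := by gcongr
  linarith

lemma mem_of_tendsto_of_mem_tiles {s : ℝ} (hs : s ∈ Ioo (0 : ℝ) 1) {P : Set (ℝ × ℝ)}
    (hP : IsPeriodicTile s P) {σ : ℕ → ℝ} (hσ : ∀ m, σ m ∈ Ioo (0 : ℝ) 1)
    (hlim : Tendsto σ atTop (𝓝 s)) {T : ℕ → Set (ℝ × ℝ)} (hT : ∀ m, IsPeriodicTile (σ m) (T m))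
    {η : ℕ → ℝ} (hη : Tendsto η atTop (𝓝 0)) (hPT : ∀ m, ∀ p ∈ P, ∃ y ∈ T m, dist y p ≤ η m)
    {z : ℕ → ℝ × ℝ} (hz : ∀ m, z m ∈ T m) {z₀ : ℝ × ℝ} (hz₀ : Tendsto z atTop (𝓝 z₀)) :
    z₀ ∈ P := by
  obtain ⟨hPpoly, hPF, -, hmax⟩ := hP
  obtain ⟨V, rfl⟩ := hPpoly.1
  have hsub : convexHull ℝ (V : Set (ℝ × ℝ)) ⊆ convexHull ℝ (insert z₀ V : Set (ℝ × ℝ)) :=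
    convexHull_mono (subset_insert _ _)
  have hz₀F : z₀ ∈ F1 s := by
    have h1 := fun m => (mem_F1_iff (hσ m).1 _).1 ((hT m).2.1 (hz m))
    have c1 : Continuous fun p : ℝ × ℝ => |p.2| := by fun_prop
    have c2 : Continuous fun p : ℝ × ℝ => |p.1 - p.2| := by fun_prop
    exact (mem_F1_iff hs.1 _).2
      ⟨le_of_tendsto_of_tendsto' ((c1.tendsto z₀).comp hz₀) hlim fun m => (h1 m).1,
        le_of_tendsto' ((c2.tendsto z₀).comp hz₀) fun m => (h1 m).2⟩
  have hP'F : convexHull ℝ (insert z₀ V : Set (ℝ × ℝ)) ⊆ F1 s := by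
    refine convexHull_min (insert_subset hz₀F ((subset_convexHull ℝ _).trans hPF)) ?_
    obtain ⟨J, -, hJ⟩ := exists_halfPlanes_eq_F1 hs.1
    exact hJ ▸ convex_halfPlanes J
  have hP' : IsConvexPolygon (convexHull ℝ (insert z₀ V : Set (ℝ × ℝ))) :=
    ⟨⟨insert z₀ V, by rw [Finset.coe_insert]⟩, hPpoly.2.mono (interior_mono hsub)⟩
  have hVne : (V : Set (ℝ × ℝ)).Nonempty :=
    convexHull_nonempty_iff.1 (hPpoly.2.mono interior_subset)
  have hnear : ∀ m, ∀ u ∈ convexHull ℝ (insert z₀ V : Set (ℝ × ℝ)),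
      ∃ y ∈ T m, dist y u ≤ max (dist (z m) z₀) (η m) := by
    intro m u hu
    rw [convexHull_insert hVne, mem_convexJoin] at hu
    obtain ⟨x, rfl, p, hp, a, b, ha, hb, hab, rfl⟩ := hu
    obtain ⟨y, hy, hyp⟩ := hPT m p hp
    refine ⟨a • z m + b • y, (hT m).1.convex (hz m) hy ha hb hab, ?_⟩
    calc dist (a • z m + b • y) (a • x + b • p)
        ≤ dist (a • z m) (a • x) + dist (b • y) (b • p) := dist_add_add_le _ _ _ _
      _ = a * dist (z m) x + b * dist y p := by
        rw [dist_smul₀, dist_smul₀, Real.norm_of_nonneg ha, Real.norm_of_nonneg hb]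
      _ ≤ a * max (dist (z m) x) (η m) + b * max (dist (z m) x) (η m) := by
        gcongr
        · exact le_max_left _ _
        · exact hyp.trans (le_max_right _ _)
      _ = max (dist (z m) x) (η m) := by rw [← add_mul, hab, one_mul]
  have hη' : Tendsto (fun m => max (dist (z m) z₀) (η m)) atTop (𝓝 0) := by
    simpa using (tendsto_iff_dist_tendsto_zero.1 hz₀).max hη
  have hper : ∃ n, 0 < n ∧
      ∀ p ∈ interior (convexHull ℝ (insert z₀ V : Set (ℝ × ℝ))), IterRel s n p p := by
    refine exists_period_of_limit hs hσ hlim (U := fun m => interior (T m))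
      (fun m => (hT m).1.convex.interior)
      (fun m => (interior_mono (hT m).2.1).trans (interior_F1_subset (hσ m).1))
      (fun m => (hT m).2.2.1) ((interior_mono hP'F).trans (interior_F1_subset hs.1)) ?_
    intro q hq
    obtain ⟨δ, hδ, hball⟩ := Metric.mem_nhds_iff.1 (mem_interior_iff_mem_nhds.1 hq)
    refine ⟨δ / 2, half_pos hδ, ?_⟩
    filter_upwards [hη'.eventually (gt_mem_nhds (show (0 : ℝ) < δ / 4 by positivity))] with m hm
    refine interior_maximal ?_ Metric.isOpen_ball
    refine ball_half_subset_of_forall_near (hT m).1.convex (hT m).1.isCompact.isClosed hδ ?_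
    intro u hu
    obtain ⟨y, hy, hyu⟩ := hnear m u (hball hu)
    exact ⟨y, hy, hyu.trans hm.le⟩
  rw [hmax _ hP' hP'F hper hsub]
  exact subset_convexHull ℝ _ (mem_insert _ _)

lemma IsConvexPolygon.homothety {P : Set (ℝ × ℝ)} (hP : IsConvexPolygon P) (c : ℝ × ℝ) {t : ℝ}
    (ht : t ≠ 0) : IsConvexPolygon (AffineMap.homothety c t '' P) := by
  classical
  obtain ⟨⟨V, hV⟩, hi⟩ := hP
  refine ⟨⟨V.image (AffineMap.homothety c t), ?_⟩, ?_⟩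
  · rw [hV, AffineMap.image_convexHull, Finset.coe_image]
  · exact (hi.image _).mono ((AffineMap.homothety_isOpenMap c t ht).image_interior_subset P)

lemma Convex.homothety_image_subset_interior {P : Set (ℝ × ℝ)} (hP : Convex ℝ P) {c : ℝ × ℝ}
    (hc : c ∈ interior P) {t : ℝ} (ht : t ∈ Ioo (0 : ℝ) 1) :
    AffineMap.homothety c t '' P ⊆ interior P := by
  rintro _ ⟨p, hp, rfl⟩
  have := hP.combo_interior_self_mem_interior hc hp (sub_pos.2 ht.2) ht.1.le (by ring)
  rw [AffineMap.homothety_apply, vsub_eq_sub, vadd_eq_add]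
  convert this using 1
  module

lemma exists_tiles_of_homothety {s : ℝ} (hs : s ∈ Ioo (0 : ℝ) 1) (hirr : Irrational s)
    {sq : ℕ → ℚ} (hsq : ∀ n, (sq n : ℝ) ∈ Ioo (0 : ℝ) 1)
    (hlim : Tendsto (fun n => (sq n : ℝ)) atTop (𝓝 s)) {P : Set (ℝ × ℝ)}
    (hP : IsPeriodicTile s P) {c : ℝ × ℝ} (hc : c ∈ interior P) {t : ℝ} (ht : t ∈ Ioo (0 : ℝ) 1) :
    ∀ᶠ n in atTop, ∃ T, IsPeriodicTile (sq n) T ∧ AffineMap.homothety c t '' P ⊆ T := by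
  obtain ⟨hPpoly, hPF, ⟨N, hN, hper⟩, -⟩ := hP
  have hK := hPpoly.homothety c ht.1.ne'
  filter_upwards [hlim.eventually (eventually_iterRel_of_isCompact hs.1 hirr isOpen_interior
    hPpoly.convex.interior ((interior_mono hPF).trans (interior_F1_subset hs.1)) hN hper
    hK.isCompact (hPpoly.convex.homothety_image_subset_interior hc ht))] with n hn
  exact exists_tile_of_rational (sq n) (hsq n) hK
    (fun p hp => openF1_subset (hsq n).1 (hn p hp).1)
    ⟨N, hN, fun p hp => (hn p (interior_subset hp)).2⟩

lemma eventually_exists_tile_hausdorffDist_le {s : ℝ} (hs : s ∈ Ioo (0 : ℝ) 1)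
    (hirr : Irrational s) {sq : ℕ → ℚ} (hsq : ∀ n, (sq n : ℝ) ∈ Ioo (0 : ℝ) 1)
    (hlim : Tendsto (fun n => (sq n : ℝ)) atTop (𝓝 s)) {P : Set (ℝ × ℝ)}
    (hP : IsPeriodicTile s P) {ε : ℝ} (hε : 0 < ε) :
    ∀ᶠ n in atTop, ∃ T, IsPeriodicTile (sq n) T ∧ Metric.hausdorffDist T P ≤ ε := by
  by_contra hcon
  obtain ⟨c, hc⟩ := hP.1.2
  let r : ℕ → ℝ := fun m => 1 / (m + 2 : ℝ)
  have hr : ∀ m, r m ∈ Ioo (0 : ℝ) 1 := fun m => by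
    refine ⟨by positivity, ?_⟩
    rw [div_lt_one (by positivity)]
    linarith [m.cast_nonneg (α := ℝ)]
  have hr0 : Tendsto (fun m => r m * 4) atTop (𝓝 0) := by
    have h1 : Tendsto (fun m : ℕ => (m + 2 : ℝ)) atTop atTop :=
      tendsto_atTop_add_const_right _ _ tendsto_natCast_atTop_atTop
    simpa [r] using h1.inv_tendsto_atTop.mul_const 4
  obtain ⟨φ, hφ, hφT⟩ := extraction_forall_of_frequently fun m =>
    (not_eventually.1 hcon).and_eventually (exists_tiles_of_homothety hs hirr hsq hlim hP hc
      (t := 1 - r m) ⟨by linarith [(hr m).2], by linarith [(hr m).1]⟩)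
  choose hbad T hT hKT using hφT
  have hPT : ∀ m, ∀ p ∈ P, ∃ y ∈ T m, dist y p ≤ r m * 4 := by
    intro m p hp
    refine ⟨_, hKT m ⟨p, hp, rfl⟩, ?_⟩
    have h1 := F1_subset_closedBall hs (hP.2.1 hp)
    have h2 := F1_subset_closedBall hs (hP.2.1 (interior_subset hc))
    rw [mem_closedBall_zero_iff] at h1 h2
    rw [AffineMap.homothety_apply, vsub_eq_sub, vadd_eq_add, dist_eq_norm,
      show (1 - r m) • (p - c) + c - p = r m • (c - p) by module, norm_smul,
      Real.norm_of_nonneg (hr m).1.le]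
    have := (hr m).1.le
    gcongr
    linarith [norm_sub_le c p]
  obtain ⟨M, hM⟩ := eventually_atTop.1 (hr0.eventually (gt_mem_nhds hε))
  have hfar : ∀ m, ∃ z ∈ T (m + M), ∀ p ∈ P, ε ≤ dist z p := by
    intro m
    by_contra! hz
    refine hbad (m + M) ⟨T (m + M), hT _, Metric.hausdorffDist_le_of_mem_dist hε.le
      (fun z hzT => (hz z hzT).imp fun p hp => ⟨hp.1, hp.2.le⟩) fun p hp => ?_⟩
    obtain ⟨y, hy, hyp⟩ := hPT (m + M) p hp
    exact ⟨y, hy, by rw [dist_comm]; exact hyp.trans (hM _ (Nat.le_add_left _ _)).le⟩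
  choose z hz hzP using hfar
  obtain ⟨z₀, -, ψ, hψ, hz₀⟩ := (isCompact_closedBall (0 : ℝ × ℝ) 2).tendsto_subseq
    fun m => F1_subset_closedBall (hsq _) ((hT _).2.1 (hz m))
  have hsub : Tendsto (fun m => ψ m + M) atTop atTop :=
    tendsto_atTop_mono (fun m => Nat.le_add_right _ _) hψ.tendsto_atTop
  have hmem : z₀ ∈ P := mem_of_tendsto_of_mem_tiles hs hP
    (σ := fun m => sq (φ (ψ m + M))) (fun m => hsq _)
    (hlim.comp (hφ.tendsto_atTop.comp hsub)) (fun m => hT (ψ m + M)) (hr0.comp hsub)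
    (fun m => hPT (ψ m + M)) (fun m => hz (ψ m)) hz₀
  have := ge_of_tendsto' (hz₀.dist (tendsto_const_nhds (x := z₀))) fun m => hzP (ψ m) z₀ hmem
  rw [dist_self] at this
  exact hε.not_ge this

/-- If for every `ε > 0` an eventual choice with `d ≤ ε` is possible, then there is a single
eventual choice along which `d` tends to zero. -/
lemma exists_seq_tendsto_zero {α : Type*} {Q : ℕ → α → Prop} {d : α → ℝ} (hd : ∀ a, 0 ≤ d a)
    (h : ∀ ε > 0, ∀ᶠ n in atTop, ∃ a, Q n a ∧ d a ≤ ε) :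
    ∃ (N : ℕ) (a : ℕ → α), (∀ n, N ≤ n → Q n (a n)) ∧ Tendsto (fun n => d (a n)) atTop (𝓝 0) := by
  obtain ⟨N, hN⟩ := eventually_atTop.1 (h 1 one_pos)
  have hb : ∀ n, BddBelow (d '' {a | Q n a}) := fun n => ⟨0, by rintro _ ⟨a, -, rfl⟩; exact hd a⟩
  have hex : ∀ n, ∃ a, N ≤ n → Q n a ∧ d a < sInf (d '' {a | Q n a}) + 1 / (n + 1) := by
    intro n
    obtain ⟨b, hb, -⟩ := hN (max N n) (le_max_left _ _)
    by_cases hn : N ≤ n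
    · obtain ⟨b, hb, -⟩ := hN n hn
      obtain ⟨_, ⟨a, ha, rfl⟩, hlt⟩ := exists_lt_of_csInf_lt (s := d '' {a | Q n a}) ⟨_, b, hb, rfl⟩
        (lt_add_of_pos_right _ (Nat.one_div_pos_of_nat (n := n)))
      exact ⟨a, fun _ => ⟨ha, hlt⟩⟩
    · exact ⟨b, fun h => absurd h hn⟩
  choose a ha using hex
  refine ⟨N, a, fun n hn => (ha n hn).1, ?_⟩
  refine tendsto_order.2 ⟨fun x hx => Eventually.of_forall fun n => hx.trans_le (hd _),
    fun x hx => ?_⟩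
  filter_upwards [h (x / 2) (half_pos hx), eventually_ge_atTop N,
    tendsto_one_div_add_atTop_nhds_zero_nat.eventually (gt_mem_nhds (half_pos hx))]
    with n ⟨b, hb', hbx⟩ hn hnx
  have := csInf_le (hb n) ⟨b, hb', rfl⟩
  linarith [(ha n hn).2]

/-- **Approximation Lemma.** If rationals `s_n ∈ (0,1)` converge to an
irrational `s ∈ (0,1)`, then every periodic tile `P` of `Δ_s` is the Hausdorff limit of
periodic tiles `P_n` of `Δ_{s_n}`, for all sufficiently large `n`. -/
theorem tile_hausdorff_approximation (s : ℝ) (hs : s ∈ Ioo (0:ℝ) 1) (hirr : Irrational s)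
    (sq : ℕ → ℚ) (hsq : ∀ n, ((sq n : ℝ)) ∈ Ioo (0:ℝ) 1)
    (hlim : Tendsto (fun n => (sq n : ℝ)) atTop (𝓝 s))
    (P : Set (ℝ × ℝ)) (hP : IsPeriodicTile s P) :
    ∃ (N : ℕ) (Pn : ℕ → Set (ℝ × ℝ)),
      (∀ n, N ≤ n → IsPeriodicTile (sq n : ℝ) (Pn n)) ∧
      Tendsto (fun n => Metric.hausdorffDist (Pn n) P) atTop (𝓝 0) := by
  exact exists_seq_tendsto_zero (Q := fun n T => IsPeriodicTile (sq n : ℝ) T)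
    (fun _ => Metric.hausdorffDist_nonneg) fun ε hε =>
      eventually_exists_tile_hausdorffDist_le hs hirr hsq hlim hP hε

end
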